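/- arXiv:1412.2654 — 2 statements merged into one kernel-verified Lean document; each statement's English description precedes it below -/
import Mathlib

section
/- Let R be a commutative noetherian ring and C a semidualizing R-module, and let M be an R-module with finite C-Gorenstein injective dimension. If there is an exact sequence 0 → N → G_{dim(R)} → ⋯ → G_1 → M → 0 of R-modules in which each G_i is C-Gorenstein injective, then M is C-Gorenstein injective. -/
/-!
Common definitions: property t(p), injective hulls, (C-)Gorenstein injective modules,
(C-)Gorenstein injective / injective / flat dimensions, small support, torsion functor,
Tor and Ext modules, semidualizing and dualizing modules, depth, Cohen-Macaulay rings,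
Serre's condition (S₁), Gorenstein local rings, minimal injective resolutions.
-/

universe u

open CategoryTheory Limits DirectSum

noncomputable section

/-- An `R`-module `S` has property `t(p)`: multiplication by every `r ∉ p` is bijective on `S`,
and every element of `S` is annihilated by a power of `p`. -/
def PropT (R : Type u) [CommRing R] (p : Ideal R) (S : Type u) [AddCommGroup S]
    [Module R S] : Prop :=
  (∀ r : R, r ∉ p → Function.Bijective (fun s : S => r • s)) ∧
  (∀ x : S, ∃ m : ℕ, 0 < m ∧ ∀ a ∈ p ^ m, a • x = 0)

/-- `E` is an injective hull of `N` over `R`: `E` is injective and `N` embeds in `E` as an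
essential submodule. -/
def IsInjectiveHull (R : Type u) [CommRing R] (N : Type u) [AddCommGroup N] [Module R N]
    (E : Type u) [AddCommGroup E] [Module R E] : Prop :=
  Module.Injective R E ∧ ∃ ι : N →ₗ[R] E, Function.Injective ι ∧
    ∀ K : Submodule R E, K ≠ ⊥ → K ⊓ LinearMap.range ι ≠ ⊥

/-- A complete injective resolution: a doubly infinite exact sequence of injective modules
which stays exact after applying `Hom_R(-, I)` for every injective module `I`. -/
structure CompleteInjRes (R : Type u) [CommRing R] where
  E : ℤ → Type u
  [acg : ∀ i, AddCommGroup (E i)]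
  [mod : ∀ i, Module R (E i)]
  d : ∀ i, E i →ₗ[R] E (i + 1)
  inj : ∀ i, Module.Injective R (E i)
  exct : ∀ i, LinearMap.range (d i) = LinearMap.ker (d (i + 1))
  homExact : ∀ (I : Type u) [AddCommGroup I] [Module R I], Module.Injective R I →
    ∀ (i : ℤ) (g : E (i + 1) →ₗ[R] I), g ∘ₗ d i = 0 →
      ∃ h : E (i + 1 + 1) →ₗ[R] I, h ∘ₗ d (i + 1) = g

attribute [instance] CompleteInjRes.acg CompleteInjRes.mod

/-- `G` is a Gorenstein injective `R`-module: it is the image of some map in a complete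
injective resolution. -/
def GorensteinInjective (R : Type u) [CommRing R] (G : Type u) [AddCommGroup G]
    [Module R G] : Prop :=
  ∃ X : CompleteInjRes R, Nonempty (G ≃ₗ[R] LinearMap.range (X.d 0))

/-- A complete `I_C I`-resolution: an exact sequence
`⋯ → Hom(C,I₁) → Hom(C,I₀) → I⁰ → I¹ → ⋯` (terms in nonnegative degrees are injective,
terms in negative degrees are of the form `Hom_R(C, I)` with `I` injective) such that
`Hom_R(Hom_R(C,J), -)` leaves it exact for every injective `R`-module `J`. -/
structure CompleteICIRes (R : Type u) [CommRing R] (C : Type u) [AddCommGroup C]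
    [Module R C] where
  X : ℤ → Type u
  [acg : ∀ i, AddCommGroup (X i)]
  [mod : ∀ i, Module R (X i)]
  d : ∀ i, X i →ₗ[R] X (i + 1)
  exct : ∀ i, LinearMap.range (d i) = LinearMap.ker (d (i + 1))
  injPos : ∀ i : ℤ, 0 ≤ i → Module.Injective R (X i)
  homCInjNeg : ∀ i : ℤ, i < 0 → ∃ (I : Type u) (_ : AddCommGroup I) (_ : Module R I),
    Module.Injective R I ∧ Nonempty (X i ≃ₗ[R] (C →ₗ[R] I))
  homExact : ∀ (J : Type u) [AddCommGroup J] [Module R J], Module.Injective R J →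
    ∀ (i : ℤ) (g : (C →ₗ[R] J) →ₗ[R] X (i + 1)), d (i + 1) ∘ₗ g = 0 →
      ∃ h : (C →ₗ[R] J) →ₗ[R] X i, d i ∘ₗ h = g

attribute [instance] CompleteICIRes.acg CompleteICIRes.mod

/-- `G` is a `C`-Gorenstein injective `R`-module: it is the image of the map
`Hom_R(C, I₀) → I⁰` in some complete `I_C I`-resolution. -/
def CGorensteinInjective (R : Type u) [CommRing R] (C : Type u) [AddCommGroup C] [Module R C]
    (G : Type u) [AddCommGroup G] [Module R G] : Prop :=
  ∃ X : CompleteICIRes R C, Nonempty (G ≃ₗ[R] LinearMap.range (X.d (-1)))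

/-- `M` has a `C`-Gorenstein injective coresolution `0 → M → G⁰ → ⋯ → Gⁿ → 0`,
i.e. `C`-Gorenstein injective dimension at most `n`. -/
def CGidLE (R : Type u) [CommRing R] (C : Type u) [AddCommGroup C] [Module R C] :
    ℕ → ModuleCat.{u} R → Prop
  | 0, M => CGorensteinInjective R C M
  | n + 1, M => ∃ (G : ModuleCat.{u} R), CGorensteinInjective R C G ∧
      ∃ ι : M →ₗ[R] G, Function.Injective ι ∧
        CGidLE R C n (ModuleCat.of R (G ⧸ LinearMap.range ι))

/-- The `C`-Gorenstein injective dimension of `M` (equal to `⊤` if `M` admits no bounded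
coresolution by `C`-Gorenstein injective modules). -/
def CGid (R : Type u) [CommRing R] (C : Type u) [AddCommGroup C] [Module R C]
    (M : Type u) [AddCommGroup M] [Module R M] : ℕ∞ :=
  sInf {n : ℕ∞ | ∃ m : ℕ, (m : ℕ∞) = n ∧ CGidLE R C m (ModuleCat.of R M)}

/-- There exists an exact sequence `0 → N → Gₙ → ⋯ → G₁ → M → 0` in which each `Gᵢ` is
`C`-Gorenstein injective (and `N` is arbitrary). -/
def CGICoresApprox (R : Type u) [CommRing R] (C : Type u) [AddCommGroup C] [Module R C] :
    ℕ → ModuleCat.{u} R → Prop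
  | 0, _ => True
  | n + 1, M => ∃ (G : ModuleCat.{u} R), CGorensteinInjective R C G ∧
      ∃ π : G →ₗ[R] M, Function.Surjective π ∧
        CGICoresApprox R C n (ModuleCat.of R (LinearMap.ker π))

/-- The `a`-torsion submodule `Γ_a(N)` of `N`. -/
def torsionSubmodule (R : Type u) [CommRing R] (a : Ideal R) (N : Type u) [AddCommGroup N]
    [Module R N] : Submodule R N :=
  ⨆ m : ℕ, Submodule.torsionBySet R N ((a ^ m : Ideal R) : Set R)

/-- `Tor_i^R(M, N)`, as an object of `ModuleCat R`. -/
abbrev TorM (R : Type u) [CommRing R] (i : ℕ) (M N : Type u) [AddCommGroup M] [Module R M]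
    [AddCommGroup N] [Module R N] : ModuleCat.{u} R :=
  ((Tor (ModuleCat.{u} R) i).obj (ModuleCat.of R M)).obj (ModuleCat.of R N)

/-- `Ext_R^i(M, N)`, as an object of `ModuleCat R`. -/
abbrev ExtM (R : Type u) [CommRing R] (i : ℕ) (M N : Type u) [AddCommGroup M] [Module R M]
    [AddCommGroup N] [Module R N] : ModuleCat.{u} R :=
  ((Ext R (ModuleCat.{u} R) i).obj (Opposite.op (ModuleCat.of R M))).obj (ModuleCat.of R N)

/-- The small support of `M`: primes `p` such that `Tor_i^R(κ(p), M) ≠ 0` for some `i`,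
where `κ(p)` is the residue field of `R_p`. -/
def smallSupport (R : Type u) [CommRing R] (M : Type u) [AddCommGroup M] [Module R M] :
    Set (PrimeSpectrum R) :=
  {p | ∃ i : ℕ,
    Nontrivial (TorM R i (IsLocalRing.ResidueField (Localization.AtPrime p.asIdeal)) M)}

/-- `C` is a semidualizing `R`-module: finitely generated, the homothety map
`R → Hom_R(C,C)` is bijective, and `Ext_R^i(C,C) = 0` for `i ≥ 1`. -/
def IsSemidualizing (R : Type u) [CommRing R] (C : Type u) [AddCommGroup C] [Module R C] : Prop :=
  Module.Finite R C ∧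
  Function.Bijective (fun r : R => (r • LinearMap.id : C →ₗ[R] C)) ∧
  ∀ i : ℕ, 1 ≤ i → Subsingleton (ExtM R i C C)

/-- `M` has injective dimension at most `n`. -/
def InjDimLE (R : Type u) [CommRing R] : ℕ → ModuleCat.{u} R → Prop
  | 0, M => Module.Injective R M
  | n + 1, M => ∃ (I : ModuleCat.{u} R), Module.Injective R I ∧
      ∃ ι : M →ₗ[R] I, Function.Injective ι ∧
        InjDimLE R n (ModuleCat.of R (I ⧸ LinearMap.range ι))

/-- `M` has flat dimension at most `n`. -/
def FlatDimLE (R : Type u) [CommRing R] : ℕ → ModuleCat.{u} R → Prop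
  | 0, M => Module.Flat R M
  | n + 1, M => ∃ (F : ModuleCat.{u} R), Module.Flat R F ∧
      ∃ π : F →ₗ[R] M, Function.Surjective π ∧
        FlatDimLE R n (ModuleCat.of R (LinearMap.ker π))

/-- `D` is a dualizing `R`-module: semidualizing of finite injective dimension. -/
def IsDualizing (R : Type u) [CommRing R] (D : Type u) [AddCommGroup D] [Module R D] : Prop :=
  IsSemidualizing R D ∧ ∃ n : ℕ, InjDimLE R n (ModuleCat.of R D)

/-- The depth of a local ring: the supremum of lengths of regular sequences contained in
the maximal ideal. -/
def localRingDepth (A : Type u) [CommRing A] [IsLocalRing A] : ℕ∞ :=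
  sSup {n : ℕ∞ | ∃ rs : List A, (∀ r ∈ rs, r ∈ IsLocalRing.maximalIdeal A) ∧
    RingTheory.Sequence.IsRegular A rs ∧ (rs.length : ℕ∞) = n}

/-- `R` is a Cohen-Macaulay ring: for each prime `p`, `depth (R_p) = dim (R_p)`. -/
def IsCohenMacaulayRing (R : Type u) [CommRing R] : Prop :=
  ∀ (p : Ideal R) (_ : p.IsPrime),
    (localRingDepth (Localization.AtPrime p) : WithBot ℕ∞) =
      ringKrullDim (Localization.AtPrime p)

/-- Serre's condition `(S₁)`: `depth (R_p) ≥ min (ht p, 1)` for every prime `p`. -/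
def SerreS1 (R : Type u) [CommRing R] : Prop :=
  ∀ (p : Ideal R) (hp : p.IsPrime),
    min (Order.height (⟨p, hp⟩ : PrimeSpectrum R)) 1 ≤ localRingDepth (Localization.AtPrime p)

/-- A Gorenstein local ring: a noetherian local ring of finite self-injective dimension. -/
def IsGorensteinLocalRing (A : Type u) [CommRing A] : Prop :=
  IsLocalRing A ∧ IsNoetherianRing A ∧ ∃ n : ℕ, InjDimLE A n (ModuleCat.of A A)

/-- A minimal injective resolution `0 → D → J⁰ → J¹ → ⋯` of `D`: an exact sequence with all
`Jⁱ` injective, in which the kernel of each differential is an essential submodule. -/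
structure MinimalInjRes (R : Type u) [CommRing R] (D : Type u) [AddCommGroup D]
    [Module R D] where
  J : ℕ → Type u
  [acg : ∀ i, AddCommGroup (J i)]
  [mod : ∀ i, Module R (J i)]
  ε : D →ₗ[R] J 0
  d : ∀ i, J i →ₗ[R] J (i + 1)
  inj : ∀ i, Module.Injective R (J i)
  ε_inj : Function.Injective ε
  exct0 : LinearMap.range ε = LinearMap.ker (d 0)
  exct : ∀ i, LinearMap.range (d i) = LinearMap.ker (d (i + 1))
  minimal : ∀ i, ∀ K : Submodule R (J i), K ≠ ⊥ → K ⊓ LinearMap.ker (d i) ≠ ⊥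

attribute [instance] MinimalInjRes.acg MinimalInjRes.mod

end

section ExtTorsion

variable {R : Type u} [CommRing R]

/-- Every element of `Ext_R^n(X, Y)` is killed by some element of `S`. For `S = ⊥` this says that
the group vanishes. -/
def ExtTorsion (S : Submonoid R) (X Y : Type u) [AddCommGroup X] [Module R X]
    [AddCommGroup Y] [Module R Y] (n : ℕ) : Prop :=
  ∀ e : Abelian.Ext (ModuleCat.of R X) (ModuleCat.of R Y) n, ∃ s ∈ S, s • e = 0

namespace ExtTorsion

variable {S : Submonoid R} {A B D X Y : Type u} [AddCommGroup A] [Module R A]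
  [AddCommGroup B] [Module R B] [AddCommGroup D] [Module R D] [AddCommGroup X] [Module R X]
  [AddCommGroup Y] [Module R Y]

lemma of_bot {n : ℕ} (h : ExtTorsion (⊥ : Submonoid R) X Y n) : ExtTorsion S X Y n := by
  intro e
  obtain ⟨s, hs, h⟩ := h e
  obtain rfl := Submonoid.mem_bot.mp hs
  exact ⟨1, S.one_mem, h⟩

lemma of_injective (hY : Module.Injective R Y) (n : ℕ) : ExtTorsion S X Y (n + 1) := by
  intro e
  have : CategoryTheory.Injective (ModuleCat.of R Y) :=
    Module.injective_object_of_injective_module R Y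
  exact ⟨1, S.one_mem, by rw [e.eq_zero_of_injective, smul_zero]⟩

lemma of_projective [Module.Projective R X] (n : ℕ) : ExtTorsion S X Y (n + 1) := by
  intro e
  have : CategoryTheory.Projective (ModuleCat.of R X) :=
    ModuleCat.projective_of_categoryTheory_projective _
  exact ⟨1, S.one_mem, by rw [e.eq_zero_of_projective, smul_zero]⟩

/-- Torsion of `Ext` in the first argument passes along maps that compose to an element of `S`. -/
lemma of_smul_source {n : ℕ} (h : ExtTorsion S A Y n) (f : A →ₗ[R] B) (g : B →ₗ[R] A) {s : R}
    (hs : s ∈ S) (hfg : f ∘ₗ g = s • LinearMap.id) : ExtTorsion S B Y n := by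
  intro e
  obtain ⟨t, ht, h⟩ := h ((Abelian.Ext.mk₀ (ModuleCat.ofHom f)).comp e (zero_add n))
  refine ⟨t * s, S.mul_mem ht hs, ?_⟩
  have h2 : s • e = (Abelian.Ext.mk₀ (ModuleCat.ofHom g)).comp
      ((Abelian.Ext.mk₀ (ModuleCat.ofHom f)).comp e (zero_add n)) (zero_add n) := by
    rw [Abelian.Ext.mk₀_comp_mk₀_assoc, ← ModuleCat.ofHom_comp, hfg]
    have : ModuleCat.ofHom (s • LinearMap.id : B →ₗ[R] B) = s • 𝟙 (ModuleCat.of R B) := rfl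
    rw [this, Abelian.Ext.mk₀_smul, Abelian.Ext.smul_comp, Abelian.Ext.mk₀_id_comp]
  rw [mul_smul, h2, ← Abelian.Ext.comp_smul, h, Abelian.Ext.comp_zero]

lemma of_smul_target {n : ℕ} (h : ExtTorsion S X A n) (f : A →ₗ[R] B) (g : B →ₗ[R] A) {s : R}
    (hs : s ∈ S) (hfg : f ∘ₗ g = s • LinearMap.id) : ExtTorsion S X B n := by
  intro e
  obtain ⟨t, ht, h⟩ := h (e.comp (Abelian.Ext.mk₀ (ModuleCat.ofHom g)) (add_zero n))
  refine ⟨t * s, S.mul_mem ht hs, ?_⟩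
  have h2 : s • e = (e.comp (Abelian.Ext.mk₀ (ModuleCat.ofHom g)) (add_zero n)).comp
      (Abelian.Ext.mk₀ (ModuleCat.ofHom f)) (add_zero n) := by
    rw [Abelian.Ext.comp_assoc _ _ _ (add_zero n) (add_zero 0) (by simp),
      Abelian.Ext.mk₀_comp_mk₀, ← ModuleCat.ofHom_comp, hfg]
    have : ModuleCat.ofHom (s • LinearMap.id : B →ₗ[R] B) = s • 𝟙 (ModuleCat.of R B) := rfl
    rw [this, Abelian.Ext.smul_eq_comp_mk₀]
  rw [mul_smul, h2, ← Abelian.Ext.smul_comp, h, Abelian.Ext.zero_comp]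

lemma congr_target {n : ℕ} (h : ExtTorsion S X A n) (e : A ≃ₗ[R] B) : ExtTorsion S X B n :=
  h.of_smul_target e.toLinearMap e.symm.toLinearMap S.one_mem (by ext; simp)

end ExtTorsion

/-- The short exact sequence of `ModuleCat R` given by an injective, exact, surjective pair. -/
lemma shortExact_of_linearMap {A B D : Type u} [AddCommGroup A] [Module R A]
    [AddCommGroup B] [Module R B] [AddCommGroup D] [Module R D] {f : A →ₗ[R] B} {g : B →ₗ[R] D}
    (hf : Function.Injective f) (hfg : Function.Exact f g) (hg : Function.Surjective g) :
    (ShortComplex.mk (ModuleCat.ofHom f) (ModuleCat.ofHom g)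
      (by rw [← ModuleCat.ofHom_comp, hfg.linearMap_comp_eq_zero]; rfl)).ShortExact where
  exact := (ShortComplex.ShortExact.moduleCat_exact_iff_function_exact _).mpr hfg
  mono_f := (ModuleCat.mono_iff_injective _).mpr hf
  epi_g := (ModuleCat.epi_iff_surjective _).mpr hg

namespace ExtTorsion

variable {S : Submonoid R} {A B D X Y : Type u} [AddCommGroup A] [Module R A]
  [AddCommGroup B] [Module R B] [AddCommGroup D] [Module R D] [AddCommGroup X] [Module R X]
  [AddCommGroup Y] [Module R Y] {f : A →ₗ[R] B} {g : B →ₗ[R] D}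

lemma covariant₁ {n : ℕ} (hf : Function.Injective f) (hfg : Function.Exact f g)
    (hg : Function.Surjective g) (h₃ : ExtTorsion S X D n) (h₂ : ExtTorsion S X B (n + 1)) :
    ExtTorsion S X A (n + 1) := by
  intro e
  obtain ⟨s, hs, h⟩ := h₂ (e.comp (Abelian.Ext.mk₀ (ModuleCat.ofHom f)) (add_zero _))
  rw [← Abelian.Ext.smul_comp] at h
  obtain ⟨x, hx⟩ := Abelian.Ext.covariant_sequence_exact₁ _ (shortExact_of_linearMap hf hfg hg)
    (s • e) h rfl
  obtain ⟨t, ht, h'⟩ := h₃ x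
  exact ⟨t * s, S.mul_mem ht hs, by
    rw [mul_smul, ← hx, ← Abelian.Ext.smul_comp, h', Abelian.Ext.zero_comp]⟩

lemma covariant₂ {n : ℕ} (hf : Function.Injective f) (hfg : Function.Exact f g)
    (hg : Function.Surjective g) (h₁ : ExtTorsion S X A n) (h₃ : ExtTorsion S X D n) :
    ExtTorsion S X B n := by
  intro e
  obtain ⟨s, hs, h⟩ := h₃ (e.comp (Abelian.Ext.mk₀ (ModuleCat.ofHom g)) (add_zero _))
  rw [← Abelian.Ext.smul_comp] at h
  obtain ⟨x, hx⟩ := Abelian.Ext.covariant_sequence_exact₂ _ (shortExact_of_linearMap hf hfg hg)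
    (s • e) h
  obtain ⟨t, ht, h'⟩ := h₁ x
  exact ⟨t * s, S.mul_mem ht hs, by
    rw [mul_smul, ← hx, ← Abelian.Ext.smul_comp, h', Abelian.Ext.zero_comp]⟩

lemma covariant₃ {n : ℕ} (hf : Function.Injective f) (hfg : Function.Exact f g)
    (hg : Function.Surjective g) (h₂ : ExtTorsion S X B n) (h₁ : ExtTorsion S X A (n + 1)) :
    ExtTorsion S X D n := by
  intro e
  obtain ⟨s, hs, h⟩ := h₁ (e.comp (shortExact_of_linearMap hf hfg hg).extClass rfl)
  rw [← Abelian.Ext.smul_comp] at h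
  obtain ⟨x, hx⟩ := Abelian.Ext.covariant_sequence_exact₃ _ (shortExact_of_linearMap hf hfg hg)
    (s • e) rfl h
  obtain ⟨t, ht, h'⟩ := h₂ x
  exact ⟨t * s, S.mul_mem ht hs, by
    rw [mul_smul, ← hx, ← Abelian.Ext.smul_comp, h', Abelian.Ext.zero_comp]⟩

lemma contravariant₁ {n : ℕ} (hf : Function.Injective f) (hfg : Function.Exact f g)
    (hg : Function.Surjective g) (h₂ : ExtTorsion S B Y n) (h₃ : ExtTorsion S D Y (n + 1)) :
    ExtTorsion S A Y n := by
  intro e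
  obtain ⟨s, hs, h⟩ := h₃ ((shortExact_of_linearMap hf hfg hg).extClass.comp e (add_comm 1 n))
  rw [← Abelian.Ext.comp_smul] at h
  obtain ⟨x, hx⟩ := Abelian.Ext.contravariant_sequence_exact₁
    (shortExact_of_linearMap hf hfg hg) _ (s • e) (add_comm 1 n) h
  obtain ⟨t, ht, h'⟩ := h₂ x
  exact ⟨t * s, S.mul_mem ht hs, by
    rw [mul_smul, ← hx, ← Abelian.Ext.comp_smul, h', Abelian.Ext.comp_zero]⟩

lemma contravariant₃ {n : ℕ} (hf : Function.Injective f) (hfg : Function.Exact f g)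
    (hg : Function.Surjective g) (h₁ : ExtTorsion S A Y n) (h₂ : ExtTorsion S B Y (n + 1)) :
    ExtTorsion S D Y (n + 1) := by
  intro e
  obtain ⟨s, hs, h⟩ := h₂ ((Abelian.Ext.mk₀ (ModuleCat.ofHom g)).comp e (zero_add _))
  rw [← Abelian.Ext.comp_smul] at h
  obtain ⟨x, hx⟩ := Abelian.Ext.contravariant_sequence_exact₃
    (shortExact_of_linearMap hf hfg hg) _ (s • e) h (add_comm 1 n)
  obtain ⟨t, ht, h'⟩ := h₁ x
  exact ⟨t * s, S.mul_mem ht hs, by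
    rw [mul_smul, ← hx, ← Abelian.Ext.comp_smul, h', Abelian.Ext.comp_zero]⟩

lemma exists_lift (hf : Function.Injective f) (hfg : Function.Exact f g)
    (hg : Function.Surjective g) (h : ExtTorsion S X A 1) (k : X →ₗ[R] D) :
    ∃ s ∈ S, ∃ l : X →ₗ[R] B, g ∘ₗ l = s • k := by
  obtain ⟨s, hs, h⟩ := h ((Abelian.Ext.mk₀ (ModuleCat.ofHom k)).comp
    (shortExact_of_linearMap hf hfg hg).extClass (zero_add 1))
  rw [← Abelian.Ext.smul_comp] at h
  obtain ⟨x, hx⟩ := Abelian.Ext.covariant_sequence_exact₃ _ (shortExact_of_linearMap hf hfg hg)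
    (s • (Abelian.Ext.mk₀ (ModuleCat.ofHom k))) (zero_add 1) h
  obtain ⟨l, rfl⟩ := (Abelian.Ext.mk₀_bijective _ _).2 x
  refine ⟨s, hs, l.hom, ?_⟩
  rw [Abelian.Ext.mk₀_comp_mk₀, ← Abelian.Ext.mk₀_smul] at hx
  have := (Abelian.Ext.mk₀_bijective _ _).1 hx
  exact congrArg ModuleCat.Hom.hom this

lemma exists_extend (hf : Function.Injective f) (hfg : Function.Exact f g)
    (hg : Function.Surjective g) (h : ExtTorsion S D Y 1) (k : A →ₗ[R] Y) :
    ∃ s ∈ S, ∃ l : B →ₗ[R] Y, l ∘ₗ f = s • k := by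
  obtain ⟨s, hs, h⟩ := h ((shortExact_of_linearMap hf hfg hg).extClass.comp
    (Abelian.Ext.mk₀ (ModuleCat.ofHom k)) (add_zero 1))
  rw [← Abelian.Ext.comp_smul] at h
  obtain ⟨x, hx⟩ := Abelian.Ext.contravariant_sequence_exact₁
    (shortExact_of_linearMap hf hfg hg) _ (s • (Abelian.Ext.mk₀ (ModuleCat.ofHom k)))
    (add_zero 1) h
  obtain ⟨l, rfl⟩ := (Abelian.Ext.mk₀_bijective _ _).2 x
  refine ⟨s, hs, l.hom, ?_⟩
  rw [Abelian.Ext.mk₀_comp_mk₀, ← Abelian.Ext.mk₀_smul] at hx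
  have := (Abelian.Ext.mk₀_bijective _ _).1 hx
  exact congrArg ModuleCat.Hom.hom this

lemma of_exists_lift (hf : Function.Injective f) (hfg : Function.Exact f g)
    (hg : Function.Surjective g) (h : ∀ k : X →ₗ[R] D, ∃ s ∈ S, ∃ l : X →ₗ[R] B, g ∘ₗ l = s • k)
    (h₂ : ExtTorsion S X B 1) : ExtTorsion S X A 1 := by
  intro e
  obtain ⟨s, hs, h'⟩ := h₂ (e.comp (Abelian.Ext.mk₀ (ModuleCat.ofHom f)) (add_zero _))
  rw [← Abelian.Ext.smul_comp] at h'
  obtain ⟨x, hx⟩ := Abelian.Ext.covariant_sequence_exact₁ _ (shortExact_of_linearMap hf hfg hg)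
    (s • e) h' (zero_add 1)
  obtain ⟨k, rfl⟩ := (Abelian.Ext.mk₀_bijective _ _).2 x
  obtain ⟨t, ht, l, hl⟩ := h k.hom
  refine ⟨t * s, S.mul_mem ht hs, ?_⟩
  have hk : t • k = ModuleCat.ofHom l ≫ ModuleCat.ofHom g :=
    ModuleCat.hom_ext hl.symm
  rw [mul_smul, ← hx, ← Abelian.Ext.smul_comp, ← Abelian.Ext.mk₀_smul, hk,
    ← Abelian.Ext.mk₀_comp_mk₀, Abelian.Ext.comp_assoc _ _ _ (zero_add 0) (zero_add 1) (by simp)]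
  erw [(shortExact_of_linearMap hf hfg hg).comp_extClass]
  rw [Abelian.Ext.comp_zero]

lemma of_exists_extend (hf : Function.Injective f) (hfg : Function.Exact f g)
    (hg : Function.Surjective g) (h : ∀ k : A →ₗ[R] Y, ∃ s ∈ S, ∃ l : B →ₗ[R] Y, l ∘ₗ f = s • k)
    (h₂ : ExtTorsion S B Y 1) : ExtTorsion S D Y 1 := by
  intro e
  obtain ⟨s, hs, h'⟩ := h₂ ((Abelian.Ext.mk₀ (ModuleCat.ofHom g)).comp e (zero_add _))
  rw [← Abelian.Ext.comp_smul] at h'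
  obtain ⟨x, hx⟩ := Abelian.Ext.contravariant_sequence_exact₃
    (shortExact_of_linearMap hf hfg hg) _ (s • e) h' (add_zero 1)
  obtain ⟨k, rfl⟩ := (Abelian.Ext.mk₀_bijective _ _).2 x
  obtain ⟨t, ht, l, hl⟩ := h k.hom
  refine ⟨t * s, S.mul_mem ht hs, ?_⟩
  have hk : t • k = ModuleCat.ofHom f ≫ ModuleCat.ofHom l :=
    ModuleCat.hom_ext hl.symm
  rw [mul_smul, ← hx, ← Abelian.Ext.comp_smul, ← Abelian.Ext.mk₀_smul, hk,
    ← Abelian.Ext.mk₀_comp_mk₀, ← Abelian.Ext.comp_assoc _ _ _ (add_zero 1) (zero_add 0) (by simp)]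
  erw [(shortExact_of_linearMap hf hfg hg).extClass_comp]
  rw [Abelian.Ext.zero_comp]

end ExtTorsion

end ExtTorsion

lemma extTorsion_bot_of_subsingleton_extM {R : Type u} [CommRing R] {X Y : Type u}
    [AddCommGroup X] [Module R X] [AddCommGroup Y] [Module R Y] {n : ℕ} (hn : 1 ≤ n)
    (h : Subsingleton (ExtM R n X Y)) : ExtTorsion (⊥ : Submonoid R) X Y n := by
  obtain ⟨n, rfl⟩ := Nat.exists_eq_add_of_le' hn
  let P := ProjectiveResolution.of (ModuleCat.of R X)
  have h0 : IsZero ((P.complex.linearYonedaObj R (ModuleCat.of R Y)).homology (n + 1)) :=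
    (ModuleCat.isZero_of_subsingleton (ExtM R (n + 1) X Y)).of_iso
      (P.isoExt (n + 1) (ModuleCat.of R Y)).symm
  rw [← HomologicalComplex.exactAt_iff_isZero_homology,
    HomologicalComplex.exactAt_iff' _ n (n + 1) (n + 2) (by simp) (by simp),
    ShortComplex.moduleCat_exact_iff] at h0
  intro e
  refine ⟨1, rfl, ?_⟩
  rw [one_smul]
  obtain ⟨f, hf, rfl⟩ := P.extMk_surjective e (n + 2) rfl
  rw [P.extMk_eq_zero_iff f (n + 2) rfl hf n rfl]
  obtain ⟨g, hg⟩ := h0 f hf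
  exact ⟨g, hg⟩

section TensorEvaluation

open TensorProduct

variable {R : Type u} [CommRing R]

/-- A map to an injective module factors through every map with smaller kernel. -/
lemma Module.Injective.exists_comp_eq {A B J : Type u} [AddCommGroup A] [Module R A]
    [AddCommGroup B] [Module R B] [AddCommGroup J] [Module R J] [Module.Injective R J]
    (β : A →ₗ[R] B) (h : A →ₗ[R] J) (hβ : LinearMap.ker β ≤ LinearMap.ker h) :
    ∃ g : B →ₗ[R] J, g ∘ₗ β = h := by
  obtain ⟨g, hg⟩ := Module.Injective.out ((LinearMap.ker β).liftQ β le_rfl)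
    (LinearMap.ker_eq_bot.mp (Submodule.ker_liftQ_eq_bot _ _ _ le_rfl))
    ((LinearMap.ker β).liftQ h hβ)
  refine ⟨g, ?_⟩
  ext a
  simpa using hg (Submodule.Quotient.mk a)

/-- The evaluation map `C ⊗ Hom(C, J) → J`. -/
noncomputable def tensorEval (R C J : Type u) [CommRing R] [AddCommGroup C] [Module R C]
    [AddCommGroup J] [Module R J] : C ⊗[R] (C →ₗ[R] J) →ₗ[R] J :=
  TensorProduct.lift LinearMap.id.flip

variable {C J : Type u} [AddCommGroup C] [Module R C] [AddCommGroup J] [Module R J]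

@[simp] lemma tensorEval_tmul (c : C) (h : C →ₗ[R] J) : tensorEval R C J (c ⊗ₜ h) = h c := rfl

lemma exists_eq_sum_single_tmul {n : ℕ} {N : Type u} [AddCommGroup N] [Module R N]
    (t : (Fin n → R) ⊗[R] N) : ∃ h : Fin n → N, t = ∑ i, Pi.single i (1 : R) ⊗ₜ h i := by
  induction t with
  | zero => exact ⟨0, by simp⟩
  | add x y hx hy =>
    obtain ⟨hx, rfl⟩ := hx
    obtain ⟨hy, rfl⟩ := hy
    exact ⟨hx + hy, by simp [TensorProduct.tmul_add, Finset.sum_add_distrib]⟩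
  | tmul x y =>
    refine ⟨fun i => x i • y, ?_⟩
    simp_rw [TensorProduct.tmul_smul, TensorProduct.smul_tmul', ← TensorProduct.sum_tmul]
    congr 1
    exact pi_eq_sum_univ' x

/-- For `Z` finitely generated and `J` injective, the evaluation map
`Z ⊗ Hom(C, J) → Hom(Hom(Z, C), J)` is injective. -/
lemma eq_zero_of_tensorEval_eq_zero [IsNoetherianRing R] [Module.Injective R J] {Z : Type u}
    [AddCommGroup Z] [Module R Z] [Module.Finite R Z] (t : Z ⊗[R] (C →ₗ[R] J))
    (ht : ∀ ψ : Z →ₗ[R] C, tensorEval R C J (ψ.rTensor _ t) = 0) : t = 0 := by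
  classical
  obtain ⟨n, π, hπ⟩ := Module.Finite.exists_fin' R Z
  obtain ⟨m, b, hb⟩ := Submodule.fg_iff_exists_fin_generating_family.mp
    (IsNoetherian.noetherian (LinearMap.ker π))
  obtain ⟨t, rfl⟩ := LinearMap.rTensor_surjective (C →ₗ[R] J) hπ t
  obtain ⟨h, rfl⟩ := exists_eq_sum_single_tmul t
  let β : (Fin n → C) →ₗ[R] (Fin m → C) :=
    LinearMap.pi fun k => ∑ i, b k i • LinearMap.proj i
  let H : (Fin n → C) →ₗ[R] J := ∑ i, h i ∘ₗ LinearMap.proj i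
  have hβ : LinearMap.ker β ≤ LinearMap.ker H := by
    intro c hc
    have hc' : ∀ k, ∑ i, b k i • c i = 0 := fun k => by
      simpa [β] using congrFun (LinearMap.mem_ker.mp hc) k
    let χ : (Fin n → R) →ₗ[R] C := Fintype.linearCombination R c
    have hχ : LinearMap.ker π ≤ LinearMap.ker χ := by
      rw [← hb, Submodule.span_le]
      rintro _ ⟨k, rfl⟩
      simpa [χ, Fintype.linearCombination_apply] using hc' k
    obtain ⟨ψ, hψ⟩ : ∃ ψ : Z →ₗ[R] C, ψ ∘ₗ π = χ := by
      refine ⟨(LinearMap.ker π).liftQ χ hχ ∘ₗ (π.quotKerEquivOfSurjective hπ).symm.toLinearMap, ?_⟩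
      ext i
      simp [LinearMap.quotKerEquivOfSurjective_symm_apply]
    have := ht ψ
    rw [← LinearMap.comp_apply (ψ.rTensor _), ← LinearMap.rTensor_comp, hψ] at this
    simpa [H, χ, Fintype.linearCombination_apply] using this
  obtain ⟨g, hg⟩ := Module.Injective.exists_comp_eq β H hβ
  have hh : ∀ i, h i = ∑ k, b k i • (g ∘ₗ LinearMap.single R (fun _ => C) k) := by
    intro i
    ext c
    have h1 := LinearMap.congr_fun hg (Pi.single i c)
    have h2 : β (Pi.single i c) = ∑ k, Pi.single k (b k i • c) := by
      ext k
      simp [β, Pi.single_apply]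
    rw [LinearMap.comp_apply, h2] at h1
    have h3 : H (Pi.single i c) = h i c := by
      simp only [H, LinearMap.sum_apply, LinearMap.comp_apply, LinearMap.proj_apply]
      rw [Finset.sum_eq_single i] <;> simp +contextual
    rw [← h3, ← h1]
    simp [Pi.single_smul]
  have hb' : ∀ k, π (b k) = 0 := fun k => by
    have : b k ∈ LinearMap.ker π := hb ▸ Submodule.subset_span ⟨k, rfl⟩
    exact this
  simp_rw [map_sum, LinearMap.rTensor_tmul, hh, TensorProduct.tmul_sum, TensorProduct.tmul_smul]
  rw [Finset.sum_comm]
  refine Finset.sum_eq_zero fun k _ => ?_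
  simp_rw [TensorProduct.smul_tmul', ← TensorProduct.sum_tmul, ← map_smul, ← map_sum]
  rw [← pi_eq_sum_univ', hb', TensorProduct.zero_tmul]

end TensorEvaluation

section Foxby

open TensorProduct

variable {R : Type u} [CommRing R] {C : Type u} [AddCommGroup C] [Module R C]

namespace IsSemidualizing

lemma extTorsion_self (hC : IsSemidualizing R C) (i : ℕ) :
    ExtTorsion (⊥ : Submonoid R) C C (i + 1) :=
  extTorsion_bot_of_subsingleton_extM (by omega) (hC.2.2 (i + 1) (by omega))

variable {I J : Type u} [AddCommGroup I] [Module R I] [Module.Injective R I]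
  [AddCommGroup J] [Module R J] [Module.Injective R J]

lemma tensorEval_bijective [IsNoetherianRing R] (hC : IsSemidualizing R C) :
    Function.Bijective (tensorEval R C I) := by
  have := hC.1
  constructor
  · rw [injective_iff_map_eq_zero]
    intro t ht
    refine eq_zero_of_tensorEval_eq_zero t fun ψ => ?_
    obtain ⟨r, rfl⟩ := hC.2.1.2 ψ
    simp [LinearMap.rTensor_smul, ht]
  · intro e
    obtain ⟨n, c, hc⟩ := Module.Finite.exists_fin (R := R) (M := C)
    let β : R →ₗ[R] (Fin n → C) := LinearMap.pi fun i => LinearMap.toSpanSingleton R C (c i)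
    have hβ : LinearMap.ker β ≤ LinearMap.ker (LinearMap.toSpanSingleton R I e) := by
      intro r hr
      have hr' : ∀ i, r • c i = 0 := fun i => congrFun (LinearMap.mem_ker.mp hr) i
      have : r • (LinearMap.id : C →ₗ[R] C) = (0 : R) • LinearMap.id := by
        rw [zero_smul]
        refine LinearMap.ext_on_range hc fun i => by simpa using hr' i
      have : r = 0 := hC.2.1.1 this
      simp [this]
    obtain ⟨g, hg⟩ := Module.Injective.exists_comp_eq β _ hβ
    refine ⟨∑ i, c i ⊗ₜ (g ∘ₗ LinearMap.single R (fun _ => C) i), ?_⟩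
    have h1 : g (β 1) = e := by simpa using LinearMap.congr_fun hg 1
    rw [map_sum]
    simp only [tensorEval_tmul, LinearMap.comp_apply, ← map_sum, LinearMap.single_apply]
    rw [← h1]
    congr 1
    simp [β, Finset.univ_sum_single]
    ext i
    simp

/-- Foxby equivalence: every linear map `Hom(C, I) → Hom(C, J)` with `I` and `J` injective is
composition with a map `I → J`. -/
lemma exists_eq_compRight [IsNoetherianRing R] (hC : IsSemidualizing R C)
    (φ : (C →ₗ[R] I) →ₗ[R] (C →ₗ[R] J)) :
    ∃ f : I →ₗ[R] J, (∀ h, φ h = f ∘ₗ h) ∧ (Function.Surjective φ → Function.Surjective f) := by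
  let e := LinearEquiv.ofBijective _ (hC.tensorEval_bijective (I := I))
  refine ⟨tensorEval R C J ∘ₗ φ.lTensor C ∘ₗ e.symm.toLinearMap, fun h => ?_, fun hφ => ?_⟩
  · ext c
    have : e.symm (h c) = c ⊗ₜ h := by
      rw [LinearEquiv.symm_apply_eq]; rfl
    simp [this]
  · exact hC.tensorEval_bijective.2.comp
      ((LinearMap.lTensor_surjective C hφ).comp e.symm.surjective)

end IsSemidualizing

variable {I J : Type u} [AddCommGroup I] [Module R I] [Module.Injective R I]
  [AddCommGroup J] [Module R J] [Module.Injective R J]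

/-- If all `ψ : Z → C` extend along `ι : Z → F`, then all `Hom(C, J) → Hom(Z, I)` lift to
`Hom(F, I)`. -/
lemma exists_lift_of_forall_exists_extend {Z F : Type u} [AddCommGroup Z] [Module R Z]
    [AddCommGroup F] [Module R F] [IsNoetherianRing R] [Module.Finite R Z] (ι : Z →ₗ[R] F)
    (h : ∀ ψ : Z →ₗ[R] C, ∃ χ : F →ₗ[R] C, χ ∘ₗ ι = ψ)
    (k : (C →ₗ[R] J) →ₗ[R] (Z →ₗ[R] I)) :
    ∃ l : (C →ₗ[R] J) →ₗ[R] (F →ₗ[R] I), LinearMap.lcomp R I ι ∘ₗ l = k := by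
  obtain ⟨g, hg⟩ := Module.Injective.exists_comp_eq (ι.rTensor (C →ₗ[R] J))
    (TensorProduct.lift k.flip) (by
      intro t ht
      rw [LinearMap.mem_ker] at ht ⊢
      rw [eq_zero_of_tensorEval_eq_zero t, map_zero]
      intro ψ
      obtain ⟨χ, rfl⟩ := h ψ
      rw [LinearMap.rTensor_comp, LinearMap.comp_apply, ht, map_zero, map_zero])
  refine ⟨(TensorProduct.curry g).flip, ?_⟩
  ext h z
  simpa using LinearMap.congr_fun hg (z ⊗ₜ h)

lemma Module.Injective.of_linearEquiv {R : Type u} [CommRing R] {A B : Type u} [AddCommGroup A]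
    [Module R A] [AddCommGroup B] [Module R B] (hA : Module.Injective R A) (e : A ≃ₗ[R] B) :
    Module.Injective R B :=
  Module.Baer.iff_injective.mp ((Module.Baer.iff_injective.mpr hA).of_equiv e)

/-- A presentation `0 → K → Rⁿ → Z → 0` together with the short exact sequence
`0 → Hom(Z, I) → Hom(Rⁿ, I) → Hom(K, I) → 0`, whose middle term is injective. -/
lemma exists_presentation (Z : Type u) [AddCommGroup Z] [Module R Z] [Module.Finite R Z]
    (I : Type u) [AddCommGroup I] [Module R I] [Module.Injective R I] :
    ∃ (n : ℕ) (K : Submodule R (Fin n → R)) (π : (Fin n → R) →ₗ[R] Z),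
      Function.Exact K.subtype π ∧ Function.Surjective π ∧
      Function.Injective (LinearMap.lcomp R I π) ∧
      Function.Exact (LinearMap.lcomp R I π) (LinearMap.lcomp R I K.subtype) ∧
      Function.Surjective (LinearMap.lcomp R I K.subtype) ∧
      Module.Injective R ((Fin n → R) →ₗ[R] I) := by
  obtain ⟨n, π, hπ⟩ := Module.Finite.exists_fin' R Z
  have hex : Function.Exact (LinearMap.ker π).subtype π := LinearMap.exact_subtype_ker_map π
  refine ⟨n, LinearMap.ker π, π, hex, hπ, LinearMap.lcomp_injective_of_surjective π hπ,
    LinearMap.exact_lcomp_of_exact_of_surjective _ hex hπ, fun h => ?_, ?_⟩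
  · obtain ⟨g, hg⟩ := Module.Injective.out (LinearMap.ker π).subtype
      (LinearMap.ker π).subtype_injective h
    exact ⟨g, LinearMap.ext hg⟩
  · exact Module.Injective.of_linearEquiv (Module.Injective.pi R (fun _ : Fin n => I))
      ((Pi.basisFun R (Fin n)).constr R)

/-- `Hom(C, J)` is `Ext`-orthogonal to `Hom(Z, I)` as soon as `Z` is finitely generated and
`Ext`-orthogonal to `C`. -/
lemma extTorsion_hom_hom [IsNoetherianRing R] (i : ℕ) {Z : Type u} [AddCommGroup Z] [Module R Z]
    [Module.Finite R Z]
    (hZ : ∀ i, ExtTorsion (⊥ : Submonoid R) Z C (i + 1)) :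
    ExtTorsion (⊥ : Submonoid R) (C →ₗ[R] J) (Z →ₗ[R] I) (i + 1) := by
  induction i generalizing Z with
  | zero =>
    obtain ⟨n, K, π, hex, hπ, h1, h2, h3, hinj⟩ := exists_presentation (R := R) Z I
    refine ExtTorsion.of_exists_lift h1 h2 h3 (fun k => ?_) (ExtTorsion.of_injective hinj 0)
    have hext (ψ : K →ₗ[R] C) : ∃ χ : (Fin n → R) →ₗ[R] C, χ ∘ₗ K.subtype = ψ := by
      obtain ⟨s, rfl, l, hl⟩ := ExtTorsion.exists_extend K.subtype_injective hex hπ (hZ 0) ψ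
      exact ⟨l, by rw [hl, one_smul]⟩
    obtain ⟨l, hl⟩ := exists_lift_of_forall_exists_extend K.subtype hext k
    exact ⟨1, rfl, l, by rw [hl, one_smul]⟩
  | succ i ih =>
    obtain ⟨n, K, π, hex, hπ, h1, h2, h3, hinj⟩ := exists_presentation (R := R) Z I
    have hK : ∀ i, ExtTorsion (⊥ : Submonoid R) K C (i + 1) := fun i =>
      ExtTorsion.contravariant₁ K.subtype_injective hex hπ
        (ExtTorsion.of_projective _) (hZ (i + 1))
    exact ExtTorsion.covariant₁ h1 h2 h3 (ih hK) (ExtTorsion.of_injective hinj _)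

end Foxby

section Good

variable {R : Type u} [CommRing R]

/-- `N` is `Ext`-orthogonal to all modules `Hom(C, J)` with `J` injective. -/
def WPerp (R : Type u) [CommRing R] (C N : Type u) [AddCommGroup C] [Module R C]
    [AddCommGroup N] [Module R N] : Prop :=
  ∀ (J : Type u) [AddCommGroup J] [Module R J], Module.Injective R J →
    ∀ i, ExtTorsion (⊥ : Submonoid R) (C →ₗ[R] J) N (i + 1)

/-- `N` is orthogonal to all `Hom(C, J)` with `J` injective, and has a left resolution by such
modules whose syzygies have the same orthogonality property. -/
def CGood (R : Type u) [CommRing R] (C N : Type u) [AddCommGroup C] [Module R C]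
    [AddCommGroup N] [Module R N] : Prop :=
  ∃ 𝒮 : Set (ModuleCat.{u} R), ModuleCat.of R N ∈ 𝒮 ∧ ∀ N ∈ 𝒮, WPerp R C N ∧ ∃ N' ∈ 𝒮,
    ∃ I : ModuleCat.{u} R, Module.Injective R I ∧
      ∃ (f : N' →ₗ[R] (C →ₗ[R] I)) (g : (C →ₗ[R] I) →ₗ[R] N),
        Function.Injective f ∧ Function.Exact f g ∧ Function.Surjective g

variable {C A B D N M : Type u} [AddCommGroup C] [Module R C] [AddCommGroup A] [Module R A]
  [AddCommGroup B] [Module R B] [AddCommGroup D] [Module R D] [AddCommGroup N] [Module R N]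
  [AddCommGroup M] [Module R M]

lemma WPerp.of_linearEquiv (h : WPerp R C M) (e : M ≃ₗ[R] N) : WPerp R C N :=
  fun J _ _ hJ i => (h J hJ i).congr_target e

lemma WPerp.of_injective (h : Module.Injective R N) : WPerp R C N :=
  fun _ _ _ _ i => ExtTorsion.of_injective h i

lemma WPerp.exists_lift {f : A →ₗ[R] B} {g : B →ₗ[R] D} (h : WPerp R C A)
    (hf : Function.Injective f) (hfg : Function.Exact f g) (hg : Function.Surjective g)
    {J : Type u} [AddCommGroup J] [Module R J] (hJ : Module.Injective R J)
    (k : (C →ₗ[R] J) →ₗ[R] D) : ∃ l : (C →ₗ[R] J) →ₗ[R] B, g ∘ₗ l = k := by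
  obtain ⟨s, rfl, l, hl⟩ := (h J hJ 0).exists_lift hf hfg hg k
  exact ⟨l, by rw [hl, one_smul]⟩

lemma IsSemidualizing.wPerp_hom [IsNoetherianRing R] (hC : IsSemidualizing R C) {I : Type u}
    [AddCommGroup I] [Module R I] (hI : Module.Injective R I) : WPerp R C (C →ₗ[R] I) := by
  intro J _ _ hJ i
  have := hC.1
  exact extTorsion_hom_hom i hC.extTorsion_self

namespace CGood

lemma wPerp (h : CGood R C N) : WPerp R C N := by
  obtain ⟨𝒮, hN, h⟩ := h
  exact (h _ hN).1

lemma of_exact {I : Type u} [AddCommGroup I] [Module R I] (hI : Module.Injective R I)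
    (hN : CGood R C N) (hM : WPerp R C M) {f : N →ₗ[R] (C →ₗ[R] I)} {g : (C →ₗ[R] I) →ₗ[R] M}
    (hf : Function.Injective f) (hfg : Function.Exact f g) (hg : Function.Surjective g) :
    CGood R C M := by
  obtain ⟨𝒮, hN, h⟩ := hN
  refine ⟨insert (ModuleCat.of R M) 𝒮, Set.mem_insert _ _, ?_⟩
  rintro T (rfl | hT)
  · exact ⟨hM, _, Set.mem_insert_of_mem _ hN, ModuleCat.of R I, hI, f, g, hf, hfg, hg⟩
  · obtain ⟨h1, N', hN', h2⟩ := h T hT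
    exact ⟨h1, N', Set.mem_insert_of_mem _ hN', h2⟩

lemma exists_exact (h : CGood R C N) : ∃ N' : ModuleCat.{u} R, CGood R C N' ∧
    ∃ I : ModuleCat.{u} R, Module.Injective R I ∧
      ∃ (f : N' →ₗ[R] (C →ₗ[R] I)) (g : (C →ₗ[R] I) →ₗ[R] N),
        Function.Injective f ∧ Function.Exact f g ∧ Function.Surjective g := by
  obtain ⟨𝒮, hN, h⟩ := h
  obtain ⟨-, N', hN', h2⟩ := h _ hN
  exact ⟨N', ⟨𝒮, hN', h⟩, h2⟩

lemma of_linearEquiv (h : CGood R C M) (e : M ≃ₗ[R] N) : CGood R C N := by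
  obtain ⟨N', hN', I, hI, f, g, hf, hfg, hg⟩ := h.exists_exact
  refine of_exact hI hN' (h.wPerp.of_linearEquiv e) hf (g := e.toLinearMap ∘ₗ g) ?_
    (e.surjective.comp hg)
  intro x
  simpa using hfg x

lemma exists_cover (h : CGood R C N) : ∃ I : ModuleCat.{u} R, Module.Injective R I ∧
    ∃ p : (C →ₗ[R] I) →ₗ[R] N, Function.Surjective p ∧ CGood R C (LinearMap.ker p) := by
  obtain ⟨N', hN', I, hI, f, g, hf, hfg, hg⟩ := h.exists_exact
  refine ⟨I, hI, g, hg, hN'.of_linearEquiv ?_⟩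
  exact (LinearEquiv.ofInjective f hf).trans (LinearEquiv.ofEq _ _ hfg.linearMap_ker_eq.symm)

end CGood

lemma Module.Injective.prod (hA : Module.Injective R A) (hB : Module.Injective R B) :
    Module.Injective R (A × B) where
  out X Y _ _ _ _ f hf g := by
    obtain ⟨h₁, hh₁⟩ := hA.out f hf (LinearMap.fst R A B ∘ₗ g)
    obtain ⟨h₂, hh₂⟩ := hB.out f hf (LinearMap.snd R A B ∘ₗ g)
    exact ⟨h₁.prod h₂, fun x => Prod.ext (hh₁ x) (hh₂ x)⟩

/-- The horseshoe lemma for kernels. -/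
lemma exact_ker_coprod {f : A →ₗ[R] B} {g : B →ₗ[R] D} (hf : Function.Injective f)
    (hfg : Function.Exact f g) {P Q : Type u} [AddCommGroup P] [Module R P] [AddCommGroup Q]
    [Module R Q] {p : P →ₗ[R] A} (hp : Function.Surjective p) (l : Q →ₗ[R] B) :
    ∃ (f' : LinearMap.ker p →ₗ[R] LinearMap.ker ((f ∘ₗ p).coprod l))
      (g' : LinearMap.ker ((f ∘ₗ p).coprod l) →ₗ[R] LinearMap.ker (g ∘ₗ l)),
      Function.Injective f' ∧ Function.Exact f' g' ∧ Function.Surjective g' := by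
  refine ⟨(LinearMap.inl R P Q).restrict 
      (fun x hx => by simp [LinearMap.mem_ker.mp hx]),
    (LinearMap.snd R P Q).restrict (fun x hx => ?_), ?_, ?_, ?_⟩
  · have h1 : f (p x.1) + l x.2 = 0 := by simpa using hx
    have h2 := congrArg g h1
    simpa [hfg.apply_apply_eq_zero] using h2
  · intro x y hxy
    exact Subtype.ext (congrArg (fun z => z.1.1) hxy)
  · rintro ⟨⟨x, y⟩, hx⟩
    have h1 : f (p x) + l y = 0 := by simpa using hx
    constructor
    · intro h
      have hy : y = 0 := by simpa [LinearMap.restrict_apply, Subtype.ext_iff] using h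
      subst hy
      have : p x = 0 := hf (by simpa using h1)
      exact ⟨⟨x, this⟩, rfl⟩
    · rintro ⟨z, hz⟩
      rw [← hz]
      rfl
  · rintro ⟨y, hy⟩
    obtain ⟨a, ha⟩ := (hfg (l y)).mp hy
    obtain ⟨x, rfl⟩ := hp a
    exact ⟨⟨(-x, y), by simp [ha]⟩, rfl⟩

lemma CGood.of_extension {f : A →ₗ[R] B} {g : B →ₗ[R] D} (hf : Function.Injective f)
    (hfg : Function.Exact f g) (hg : Function.Surjective g) (hA : CGood R C A)
    (hD : CGood R C D) : CGood R C B := by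
  refine ⟨{B | ∃ A D : ModuleCat.{u} R, CGood R C A ∧ CGood R C D ∧ ∃ (f : A →ₗ[R] B)
    (g : B →ₗ[R] D), Function.Injective f ∧ Function.Exact f g ∧ Function.Surjective g},
    ⟨ModuleCat.of R A, ModuleCat.of R D, hA, hD, f, g, hf, hfg, hg⟩, ?_⟩
  clear hf hfg hg hA hD
  rintro B ⟨A, D, hA, hD, f, g, hf, hfg, hg⟩
  refine ⟨fun J _ _ hJ i => ExtTorsion.covariant₂ hf hfg hg (hA.wPerp J hJ i) (hD.wPerp J hJ i),
    ?_⟩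
  obtain ⟨I₁, hI₁, p, hp, hA'⟩ := hA.exists_cover
  obtain ⟨I₂, hI₂, q, hq, hD'⟩ := hD.exists_cover
  obtain ⟨l, rfl⟩ := hA.wPerp.exists_lift hf hfg hg hI₂ q
  obtain ⟨f', g', h'⟩ := exact_ker_coprod hf hfg hp l
  let e : ((C →ₗ[R] I₁) × (C →ₗ[R] I₂)) ≃ₗ[R] (C →ₗ[R] (I₁ × I₂)) := LinearMap.prodEquiv R
  refine ⟨ModuleCat.of R (LinearMap.ker ((f ∘ₗ p).coprod l)), ⟨ModuleCat.of R (LinearMap.ker p),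
    ModuleCat.of R (LinearMap.ker (g ∘ₗ l)), hA', hD', f', g', h'⟩, ModuleCat.of R (I₁ × I₂),
    hI₁.prod hI₂, e.toLinearMap ∘ₗ Submodule.subtype _, (f ∘ₗ p).coprod l ∘ₗ e.symm.toLinearMap,
    e.injective.comp Subtype.val_injective, ?_, ?_⟩
  · intro x
    constructor
    · intro hx
      exact ⟨⟨e.symm x, hx⟩, e.apply_symm_apply x⟩
    · rintro ⟨y, rfl⟩
      simp
  · refine Function.Surjective.comp (g := (f ∘ₗ p).coprod l) (fun b => ?_) e.symm.surjective
    obtain ⟨y, hy⟩ := hq (g b)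
    obtain ⟨a, ha⟩ := (hfg (b - l y)).mp (by simpa [sub_eq_zero] using hy.symm)
    obtain ⟨x, rfl⟩ := hp a
    exact ⟨(x, y), by simp [ha]⟩

end Good

section CompleteResolution

variable {R : Type u} [CommRing R] {C : Type u} [AddCommGroup C] [Module R C]

namespace CompleteICIRes

variable (X : CompleteICIRes R C)

/-- The differential of a complete resolution, corestricted to the next cycles. -/
def toKer (j : ℤ) : X.X j →ₗ[R] LinearMap.ker (X.d (j + 1)) :=
  (X.d j).codRestrict _ fun x => X.exct j ▸ LinearMap.mem_range_self _ x

lemma exact_toKer (j : ℤ) : Function.Exact (LinearMap.ker (X.d j)).subtype (X.toKer j) := by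
  intro x
  simp [toKer, Subtype.ext_iff]

lemma toKer_surjective (j : ℤ) : Function.Surjective (X.toKer j) := by
  rintro ⟨y, hy⟩
  rw [← X.exct j] at hy
  obtain ⟨x, rfl⟩ := hy
  exact ⟨x, rfl⟩

variable [IsNoetherianRing R]

lemma wPerp_X (hC : IsSemidualizing R C) (j : ℤ) : WPerp R C (X.X j) := by
  rcases le_or_gt 0 j with h | h
  · exact .of_injective (X.injPos j h)
  · obtain ⟨I, _, _, hI, ⟨e⟩⟩ := X.homCInjNeg j h
    exact (hC.wPerp_hom hI).of_linearEquiv e.symm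

lemma wPerp_ker (hC : IsSemidualizing R C) (j : ℤ) : WPerp R C (LinearMap.ker (X.d j)) := by
  intro J _ _ hJ i
  induction i generalizing j with
  | zero =>
    refine ExtTorsion.of_exists_lift (Submodule.subtype_injective _) (X.exact_toKer j)
      (X.toKer_surjective j) (fun k => ?_) (X.wPerp_X hC j J hJ 0)
    obtain ⟨h, hh⟩ := X.homExact J hJ j (Submodule.subtype _ ∘ₗ k) (by ext x; simp)
    refine ⟨1, rfl, h, ?_⟩
    rw [one_smul]
    refine LinearMap.ext fun x => Subtype.ext ?_
    exact LinearMap.congr_fun hh x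
  | succ i ih =>
    exact ExtTorsion.covariant₁ (Submodule.subtype_injective _) (X.exact_toKer j)
      (X.toKer_surjective j) (ih (j + 1)) (X.wPerp_X hC j J hJ _)

end CompleteICIRes

lemma CGorensteinInjective.cGood [IsNoetherianRing R] (hC : IsSemidualizing R C) {G : Type u}
    [AddCommGroup G] [Module R G] (hG : CGorensteinInjective R C G) : CGood R C G := by
  obtain ⟨X, ⟨e⟩⟩ := hG
  suffices CGood R C (LinearMap.ker (X.d 0)) from
    this.of_linearEquiv ((LinearEquiv.ofEq _ _ (X.exct (-1)).symm).trans e.symm)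
  refine ⟨{N | ∃ j : ℤ, j ≤ 0 ∧ Nonempty (LinearMap.ker (X.d j) ≃ₗ[R] N)},
    ⟨0, le_rfl, ⟨.refl _ _⟩⟩, ?_⟩
  rintro N ⟨j, hj, ⟨e⟩⟩
  refine ⟨(X.wPerp_ker hC j).of_linearEquiv e, ?_⟩
  obtain ⟨j, rfl⟩ : ∃ k, j = k + 1 := ⟨j - 1, by omega⟩
  obtain ⟨I, _, _, hI, ⟨e'⟩⟩ := X.homCInjNeg j (by omega)
  refine ⟨ModuleCat.of R (LinearMap.ker (X.d j)), ⟨j, by omega, ⟨.refl _ _⟩⟩, ModuleCat.of R I,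
    hI, e'.toLinearMap ∘ₗ Submodule.subtype _, e.toLinearMap ∘ₗ X.toKer j ∘ₗ e'.symm.toLinearMap,
    e'.injective.comp Subtype.val_injective, ?_,
    e.surjective.comp ((X.toKer_surjective j).comp e'.symm.surjective)⟩
  intro x
  have := X.exact_toKer j (e'.symm x)
  simp only [LinearMap.comp_apply, LinearEquiv.coe_coe, EmbeddingLike.map_eq_zero_iff] 
  rw [this]
  constructor
  · rintro ⟨y, hy⟩
    exact ⟨y, (congrArg e' hy).trans (e'.apply_symm_apply x)⟩
  · rintro ⟨y, hy⟩
    exact ⟨y, by simp [← hy]⟩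

lemma exists_injective_embedding (N : Type u) [AddCommGroup N] [Module R N] :
    ∃ I : ModuleCat.{u} R, Module.Injective R I ∧ ∃ f : N →ₗ[R] I, Function.Injective f := by
  obtain ⟨⟨J, hJ, f, hf⟩⟩ := EnoughInjectives.presentation (ModuleCat.of R N)
  have : CategoryTheory.Injective (ModuleCat.of R J) := hJ
  exact ⟨J, Module.injective_module_of_injective_object R J, f.hom,
    (ModuleCat.mono_iff_injective f).mp hf⟩

lemma WPerp.exists_cosyzygy {N : Type u} [AddCommGroup N] [Module R N] (hN : WPerp R C N) :
    ∃ N' : ModuleCat.{u} R, WPerp R C N' ∧ ∃ I : ModuleCat.{u} R, Module.Injective R I ∧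
      ∃ (f : N →ₗ[R] I) (g : I →ₗ[R] N'),
        Function.Injective f ∧ Function.Exact f g ∧ Function.Surjective g := by
  obtain ⟨I, hI, f, hf⟩ := exists_injective_embedding (R := R) N
  have hex : Function.Exact f (LinearMap.range f).mkQ := by
    rw [LinearMap.exact_iff, Submodule.ker_mkQ]
  refine ⟨ModuleCat.of R (I ⧸ LinearMap.range f), fun J _ _ hJ i => ?_, I, hI, f,
    (LinearMap.range f).mkQ, hf, hex, Submodule.mkQ_surjective _⟩
  exact ExtTorsion.covariant₃ hf hex (Submodule.mkQ_surjective _)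
    (ExtTorsion.of_injective hI i) (hN J hJ (i + 1))

lemma CGood.exists_int_sequence {G : Type u} [AddCommGroup G] [Module R G] (hG : CGood R C G) :
    ∃ K : ℤ → ModuleCat.{u} R, K 0 = ModuleCat.of R G ∧ (∀ j, WPerp R C (K j)) ∧
      ∀ j, ∃ X : ModuleCat.{u} R, (0 ≤ j → Module.Injective R X) ∧
        (j < 0 → ∃ I : ModuleCat.{u} R, Module.Injective R I ∧ Nonempty (X ≃ₗ[R] (C →ₗ[R] I))) ∧
        ∃ (f : K j →ₗ[R] X) (g : X →ₗ[R] K (j + 1)),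
          Function.Injective f ∧ Function.Exact f g ∧ Function.Surjective g := by
  choose s hs hs' using fun N : {N : ModuleCat.{u} R // CGood R C N} => N.2.exists_exact
  choose t ht ht' using fun N : {N : ModuleCat.{u} R // WPerp R C N} => N.2.exists_cosyzygy
  let L : ℕ → {N : ModuleCat.{u} R // CGood R C N} :=
    fun n => Nat.rec ⟨ModuleCat.of R G, hG⟩ (fun _ N => ⟨s N, hs N⟩) n
  let U : ℕ → {N : ModuleCat.{u} R // WPerp R C N} :=
    fun n => Nat.rec ⟨ModuleCat.of R G, hG.wPerp⟩ (fun _ N => ⟨t N, ht N⟩) n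
  refine ⟨fun j => match j with
    | Int.ofNat n => (U n).1
    | Int.negSucc n => (L (n + 1)).1, rfl, ?_, ?_⟩
  · rintro (n | n)
    · exact (U n).2
    · exact (L (n + 1)).2.wPerp
  · rintro (n | n | n)
    · obtain ⟨I, hI, h⟩ := ht' (U n)
      exact ⟨I, fun _ => hI, fun h => absurd h (by simp), h⟩
    · obtain ⟨I, hI, h⟩ := hs' (L 0)
      exact ⟨ModuleCat.of R (C →ₗ[R] I), fun h => absurd h (by simp),
        fun _ => ⟨I, hI, ⟨.refl _ _⟩⟩, h⟩
    · obtain ⟨I, hI, h⟩ := hs' (L (n + 1))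
      exact ⟨ModuleCat.of R (C →ₗ[R] I), fun h => absurd h (by simp),
        fun _ => ⟨I, hI, ⟨.refl _ _⟩⟩, h⟩

lemma CGood.cGorensteinInjective {G : Type u} [AddCommGroup G] [Module R G] (hG : CGood R C G) :
    CGorensteinInjective R C G := by
  obtain ⟨K, hK0, hK, h⟩ := hG.exists_int_sequence
  choose X hpos hneg f g hf hfg hg using h
  have hrange (i : ℤ) : LinearMap.range (f (i + 1) ∘ₗ g i) = LinearMap.range (f (i + 1)) :=
    LinearMap.range_comp_of_range_eq_top _ (LinearMap.range_eq_top.mpr (hg i))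
  let Y : CompleteICIRes R C :=
    { X := fun i => X i
      d := fun i => f (i + 1) ∘ₗ g i
      injPos := hpos
      exct := fun i => by
        rw [hrange, LinearMap.ker_comp_of_ker_eq_bot _ (LinearMap.ker_eq_bot.mpr (hf _)),
          (hfg (i + 1)).linearMap_ker_eq]
      homCInjNeg := fun i hi => by
        obtain ⟨I, hI, e⟩ := hneg i hi
        exact ⟨I, _, _, hI, e⟩
      homExact := fun J _ _ hJ i k hk => by
        have hk' (x) : g (i + 1) (k x) = 0 := hf _ (by simpa using LinearMap.congr_fun hk x)
        let k' : (C →ₗ[R] J) →ₗ[R] K (i + 1) := (LinearEquiv.ofInjective _ (hf (i + 1))).symm ∘ₗ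
          k.codRestrict (LinearMap.range (f (i + 1))) fun x => (hfg (i + 1) (k x)).mp (hk' x)
        obtain ⟨l, hl⟩ := (hK i).exists_lift (hf i) (hfg i) (hg i) hJ k'
        refine ⟨l, ?_⟩
        rw [LinearMap.comp_assoc, hl]
        refine LinearMap.ext fun x => ?_
        exact LinearEquiv.ofInjective_symm_apply (f (i + 1)) (h := hf (i + 1)) ⟨k x, _⟩ }
  have e : G ≃ₗ[R] K 0 := (eqToIso hK0).toLinearEquiv.symm
  have e' : K 0 ≃ₗ[R] LinearMap.range (f (-1 + 1)) :=
    LinearEquiv.ofInjective (f (-1 + 1)) (hf (-1 + 1))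
  exact ⟨Y, ⟨(e.trans e').trans (LinearEquiv.ofEq _ _ (hrange (-1)).symm)⟩⟩

end CompleteResolution

section RegularUpTo

variable {R : Type u} [CommRing R] {S : Submonoid R}

lemma LinearMap.exists_comp_eq_of_surjective {A B D : Type u} [AddCommGroup A] [Module R A]
    [AddCommGroup B] [Module R B] [AddCommGroup D] [Module R D] {f : A →ₗ[R] B}
    (hf : Function.Surjective f) {h : A →ₗ[R] D} (hfh : LinearMap.ker f ≤ LinearMap.ker h) :
    ∃ g : B →ₗ[R] D, g ∘ₗ f = h := by
  refine ⟨(LinearMap.ker f).liftQ h hfh ∘ₗ (f.quotKerEquivOfSurjective hf).symm.toLinearMap, ?_⟩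
  ext a
  simp [LinearMap.quotKerEquivOfSurjective_symm_apply]

/-- Multiplication by `x` is injective on `T` up to an element of `S`. -/
def SmulRegularUpTo (S : Submonoid R) (T : Type u) [AddCommGroup T] [Module R T] (x : R) : Prop :=
  ∃ s ∈ S, ∀ t : T, x • t = 0 → s • t = 0

lemma SmulRegularUpTo.extTorsion_range {T N : Type u} [AddCommGroup T] [Module R T]
    [AddCommGroup N] [Module R N] {x : R} (hx : SmulRegularUpTo S T x) {i : ℕ}
    (h : ExtTorsion S T N i) :
    ExtTorsion S (LinearMap.range (LinearMap.lsmul R T x)) N i := by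
  obtain ⟨s, hs, hx⟩ := hx
  obtain ⟨g, hg⟩ := LinearMap.exists_comp_eq_of_surjective
    (LinearMap.surjective_rangeRestrict (LinearMap.lsmul R T x)) (h := LinearMap.lsmul R T s)
    (by rw [LinearMap.ker_rangeRestrict]; exact fun t ht => hx t ht)
  refine h.of_smul_source (LinearMap.rangeRestrict (LinearMap.lsmul R T x)) g hs ?_
  refine LinearMap.ext fun ⟨y, hy⟩ => ?_
  obtain ⟨t, rfl⟩ := hy
  have : g ⟨x • t, _⟩ = s • t := LinearMap.congr_fun hg t
  refine Subtype.ext ?_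
  change x • g ⟨x • t, _⟩ = s • x • t
  rw [this, smul_comm]

lemma SmulRegularUpTo.extTorsion_succ {T T' N : Type u} [AddCommGroup T] [Module R T]
    [AddCommGroup T'] [Module R T'] [AddCommGroup N] [Module R N] {x : R}
    (hx : SmulRegularUpTo S T x) {π : T →ₗ[R] T'} (hπ : Function.Surjective π)
    (hxπ : LinearMap.ker π = LinearMap.range (LinearMap.lsmul R T x)) {i : ℕ}
    (h : ExtTorsion S T N i) (h' : ExtTorsion S T N (i + 1)) : ExtTorsion S T' N (i + 1) := by
  refine ExtTorsion.contravariant₃ (LinearMap.range (LinearMap.lsmul R T x)).subtype_injective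
    ?_ hπ (hx.extTorsion_range h) h'
  rw [LinearMap.exact_iff, hxπ, Submodule.range_subtype]

/-- Ideals generated by `j` elements forming a regular sequence, up to `S`, on `R` and on `C`. -/
inductive RegSeqUpTo (S : Submonoid R) (C : Type u) [AddCommGroup C] [Module R C] :
    ℕ → Ideal R → Prop
  | nil : RegSeqUpTo S C 0 ⊥
  | cons {j : ℕ} {a : Ideal R} {x : R} : RegSeqUpTo S C j a → SmulRegularUpTo S (R ⧸ a) x →
      SmulRegularUpTo S (C ⧸ (a • ⊤ : Submodule R C)) x →
      RegSeqUpTo S C (j + 1) (a ⊔ Ideal.span {x})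

/-- Quotients by `N` and by `N + xM` form the expected exact sequence. -/
lemma ker_factor_eq_range {M : Type u} [AddCommGroup M] [Module R M] {N N' : Submodule R M}
    {x : R} (h : N' = N ⊔ LinearMap.range (LinearMap.lsmul R M x)) (hN : N ≤ N') :
    LinearMap.ker (Submodule.factor hN) = LinearMap.range (LinearMap.lsmul R (M ⧸ N) x) := by
  ext t
  obtain ⟨t, rfl⟩ := Submodule.Quotient.mk_surjective _ t
  have : (Submodule.Quotient.mk t ∈ LinearMap.ker (Submodule.factor hN)) ↔ t ∈ N' := by
    simp [LinearMap.mem_ker]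
  rw [this, h, Submodule.mem_sup]
  constructor
  · rintro ⟨y, hy, z, ⟨w, rfl⟩, rfl⟩
    refine ⟨Submodule.Quotient.mk w, ?_⟩
    simp [(Submodule.Quotient.mk_eq_zero N).mpr hy]
  · rintro ⟨w, hw⟩
    obtain ⟨w, rfl⟩ := Submodule.Quotient.mk_surjective _ w
    refine ⟨t - x • w, ?_, x • w, ⟨w, rfl⟩, by abel⟩
    rw [← Submodule.Quotient.mk_eq_zero N, Submodule.Quotient.mk_sub, sub_eq_zero]
    exact hw.symm

lemma sup_span_singleton_eq (a : Ideal R) (x : R) :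
    a ⊔ Ideal.span {x} = a ⊔ LinearMap.range (LinearMap.lsmul R R x) := by
  congr 1
  ext y
  simp [Ideal.mem_span_singleton', mul_comm]

lemma sup_span_singleton_smul_top_eq (a : Ideal R) (x : R) (C : Type u) [AddCommGroup C]
    [Module R C] : ((a ⊔ Ideal.span {x}) • ⊤ : Submodule R C) =
      a • ⊤ ⊔ LinearMap.range (LinearMap.lsmul R C x) := by
  rw [Submodule.sup_smul, Submodule.ideal_span_singleton_smul]
  congr 1
  ext y
  simp [Submodule.mem_smul_pointwise_iff_exists]

namespace RegSeqUpTo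

variable {C : Type u} [AddCommGroup C] [Module R C] {j : ℕ} {a : Ideal R}

lemma extTorsion_of_le (h : RegSeqUpTo S C j a) (N : Type u) [AddCommGroup N] [Module R N] {i : ℕ}
    (hi : j ≤ i) : ExtTorsion S (R ⧸ a) N (i + 1) := by
  induction h generalizing i with
  | nil =>
    have : Module.Projective R (R ⧸ (⊥ : Ideal R)) :=
      .of_equiv (Submodule.quotEquivOfEqBot (⊥ : Ideal R) rfl).symm
    exact ExtTorsion.of_projective i
  | cons h hx hx' ih =>
    obtain ⟨i, rfl⟩ := Nat.exists_eq_add_of_le' (Nat.one_le_of_lt hi)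
    exact hx.extTorsion_succ (Submodule.factor_surjective le_sup_left)
      (ker_factor_eq_range (sup_span_singleton_eq _ _) _) (ih (by omega)) (ih (by omega))

lemma extTorsion_hom (h : RegSeqUpTo S C j a) {I : Type u} [AddCommGroup I] [Module R I]
    [Module.Injective R I] (i : ℕ) : ExtTorsion S (R ⧸ a) (C →ₗ[R] I) (i + 1) := by
  induction h generalizing i with
  | nil => exact (nil (S := S) (C := C)).extTorsion_of_le _ (Nat.zero_le i)
  | @cons j a x h hx hx' ih =>
    have hker := ker_factor_eq_range (sup_span_singleton_eq a x) le_sup_left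
    have hsurj := Submodule.factor_surjective (le_sup_left : a ≤ a ⊔ Ideal.span {x})
    cases i with
    | succ i => exact hx.extTorsion_succ hsurj hker (ih i) (ih (i + 1))
    | zero =>
      refine ExtTorsion.of_exists_extend
        (LinearMap.range (LinearMap.lsmul R (R ⧸ a) x)).subtype_injective
        (by rw [LinearMap.exact_iff, hker, Submodule.range_subtype]) hsurj (fun g => ?_) (ih 0)
      obtain ⟨s, hs, hx'⟩ := hx'
      refine ⟨s, hs, ?_⟩
      let y (r : R) : LinearMap.range (LinearMap.lsmul R (R ⧸ a) x) :=
        ⟨x • Submodule.Quotient.mk r, Submodule.Quotient.mk r, rfl⟩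
      have hy (r : R) : y r = r • y 1 := Subtype.ext (by
        change x • Submodule.Quotient.mk r = r • x • Submodule.Quotient.mk 1
        rw [smul_comm, ← Submodule.Quotient.mk_smul a r, smul_eq_mul, mul_one])
      have h0 : (a • ⊤ : Submodule R C) ≤ LinearMap.ker (g (y 1)) := by
        rw [Submodule.smul_le]
        intro r hr c _
        have : r • y 1 = 0 := by
          rw [← hy]
          exact Subtype.ext (by
            change x • Submodule.Quotient.mk r = 0
            rw [(Submodule.Quotient.mk_eq_zero a).mpr hr, smul_zero])
        rw [LinearMap.mem_ker, map_smul, ← LinearMap.smul_apply, ← map_smul, this, map_zero,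
          LinearMap.zero_apply]
      obtain ⟨h₁, hh₁⟩ := Module.Injective.exists_comp_eq
        (LinearMap.lsmul R (C ⧸ (a • ⊤ : Submodule R C)) x ∘ₗ Submodule.mkQ _) (s • g (y 1)) (by
          intro c hc
          have h1 := hx' (Submodule.Quotient.mk c) hc
          rw [← Submodule.Quotient.mk_smul, Submodule.Quotient.mk_eq_zero] at h1
          have h2 := h0 h1
          rwa [LinearMap.mem_ker, map_smul] at h2)
      let h₂ : C →ₗ[R] I := h₁ ∘ₗ Submodule.mkQ _
      have hh₂ : a ≤ LinearMap.ker (LinearMap.toSpanSingleton R (C →ₗ[R] I) h₂) := by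
        intro r hr
        refine LinearMap.ext fun c => ?_
        have : (Submodule.Quotient.mk (r • c) : C ⧸ (a • ⊤ : Submodule R C)) = 0 :=
          (Submodule.Quotient.mk_eq_zero _).mpr (Submodule.smul_mem_smul hr trivial)
        simp [h₂, ← map_smul, this, ← Submodule.Quotient.mk_smul]
      refine ⟨a.liftQ _ hh₂, ?_⟩
      refine LinearMap.ext fun ⟨z, hz⟩ => ?_
      obtain ⟨t, rfl⟩ := hz
      obtain ⟨r, rfl⟩ := Submodule.Quotient.mk_surjective _ t
      refine LinearMap.ext fun c => ?_
      change _ = s • g (y r) c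
      have hc : h₂ (x • c) = s • g (y 1) c := LinearMap.congr_fun hh₁ c
      rw [hy, map_smul, LinearMap.smul_apply, smul_comm, ← hc]
      change ((x • r) • h₂) c = _
      rw [smul_eq_mul, mul_comm, mul_smul, LinearMap.smul_apply, LinearMap.smul_apply, map_smul]

end RegSeqUpTo

end RegularUpTo

section RegSeqVanishing

namespace RegSeqUpTo

variable {R : Type u} [CommRing R] {S : Submonoid R} {C : Type u} [AddCommGroup C] [Module R C]
  {j : ℕ} {a : Ideal R}

lemma extTorsion_of_cGood (h : RegSeqUpTo S C j a) {G : Type u} [AddCommGroup G] [Module R G]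
    (hG : CGood R C G) (i : ℕ) : ExtTorsion S (R ⧸ a) G (i + 1) := by
  suffices H : ∀ (n : ℕ) (G : ModuleCat.{u} R), CGood R C G → ∀ i, j ≤ i + n →
      ExtTorsion S (R ⧸ a) G (i + 1) from H j (ModuleCat.of R G) hG i (Nat.le_add_left j i)
  clear hG i
  intro n
  induction n with
  | zero => exact fun G _ i hi => h.extTorsion_of_le G hi
  | succ n ih =>
    intro G hG i hi
    obtain ⟨N, hN, I, hI, f, g, hf, hfg, hg⟩ := hG.exists_exact
    exact ExtTorsion.covariant₃ hf hfg hg (h.extTorsion_hom i) (ih N hN (i + 1) (by omega))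

lemma extTorsion_of_cGICoresApprox [IsNoetherianRing R] (hC : IsSemidualizing R C)
    (h : RegSeqUpTo S C j a) {n : ℕ} {M : ModuleCat.{u} R} (hM : CGICoresApprox R C n M) {i : ℕ}
    (hi : j ≤ i + n) : ExtTorsion S (R ⧸ a) M (i + 1) := by
  induction n generalizing M i with
  | zero => exact h.extTorsion_of_le M hi
  | succ n ih =>
    obtain ⟨G, hG, π, hπ, hK⟩ := hM
    exact ExtTorsion.covariant₃ (LinearMap.ker π).subtype_injective π.exact_subtype_ker_map hπ
      (h.extTorsion_of_cGood (CGorensteinInjective.cGood hC hG) i) (ih hK (by omega))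

end RegSeqUpTo

end RegSeqVanishing

section Depth

variable {R : Type u} [CommRing R]

lemma Submodule.FG.exists_mem_smul_eq_zero {M : Type u} [AddCommGroup M] [Module R M]
    {S : Submonoid R} {N : Submodule R M} (hN : N.FG) (h : ∀ m ∈ N, ∃ s ∈ S, s • m = 0) :
    ∃ s ∈ S, ∀ m ∈ N, s • m = 0 := by
  induction N, hN using Submodule.fg_induction with
  | singleton x =>
    obtain ⟨s, hs, hx⟩ := h x (Submodule.mem_span_singleton_self x)
    refine ⟨s, hs, fun m hm => ?_⟩
    obtain ⟨r, rfl⟩ := Submodule.mem_span_singleton.mp hm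
    rw [smul_comm, hx, smul_zero]
  | sup N₁ N₂ _ _ h₁ h₂ =>
    obtain ⟨s, hs, h₁⟩ := h₁ fun m hm => h m (le_sup_left (a := N₁) hm)
    obtain ⟨t, ht, h₂⟩ := h₂ fun m hm => h m (le_sup_right (a := N₁) hm)
    refine ⟨s * t, S.mul_mem hs ht, fun m hm => ?_⟩
    obtain ⟨y, hy, z, hz, rfl⟩ := Submodule.mem_sup.mp hm
    rw [smul_add, mul_smul, mul_smul, smul_comm, h₁ y hy, h₂ z hz, smul_zero, smul_zero, add_zero]

lemma SmulRegularUpTo.of_forall_exists {M : Type u} [AddCommGroup M] [Module R M]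
    [IsNoetherian R M] {S : Submonoid R} {x : R} (h : ∀ m : M, x • m = 0 → ∃ s ∈ S, s • m = 0) :
    SmulRegularUpTo S M x := by
  obtain ⟨s, hs, h⟩ := (IsNoetherian.noetherian
    (LinearMap.ker (LinearMap.lsmul R M x))).exists_mem_smul_eq_zero h
  exact ⟨s, hs, fun t ht => h t ht⟩

lemma SmulRegularUpTo.of_notMem_associatedPrimes [IsNoetherianRing R] {M : Type u}
    [AddCommGroup M] [Module R M] [Module.Finite R M] {p : Ideal R} [p.IsPrime] {x : R}
    (hx : ∀ q ∈ associatedPrimes R M, q ≤ p → x ∉ q) : SmulRegularUpTo p.primeCompl M x := by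
  refine of_forall_exists fun m hm => ?_
  by_contra! H
  have hle : Module.annihilator R (Submodule.span R {m}) ≤ p := fun s hs => by
    by_contra hsp
    refine H s hsp ?_
    have := Module.mem_annihilator.mp hs ⟨m, Submodule.mem_span_singleton_self m⟩
    exact congrArg Subtype.val this
  obtain ⟨q, hq, hqp⟩ := Ideal.exists_minimalPrimes_le hle
  refine hx q (associatedPrimes.subset_of_injective
    (Submodule.span R {m}).subtype_injective
    (Module.associatedPrimes.minimalPrimes_annihilator_subset_associatedPrimes R _ hq))
    hqp (hq.1.2 ?_)
  rw [Module.mem_annihilator]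
  rintro ⟨y, hy⟩
  obtain ⟨r, rfl⟩ := Submodule.mem_span_singleton.mp hy
  exact Subtype.ext (by change x • r • m = 0; rw [smul_comm, hm, smul_zero])

lemma SmulRegularUpTo.notMem_of_mem_associatedPrimes [IsNoetherianRing R] {M : Type u}
    [AddCommGroup M] [Module R M] {p q : Ideal R} [p.IsPrime] {x : R}
    (hx : SmulRegularUpTo p.primeCompl M x) (hq : q ∈ associatedPrimes R M) (hqp : q ≤ p) :
    x ∉ q := by
  intro hxq
  obtain ⟨s, hs, hx⟩ := hx
  obtain ⟨-, m, rfl⟩ := isAssociatedPrime_iff.mp hq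
  simp only [Submodule.mem_colon_singleton, Submodule.mem_bot] at hxq
  exact hs (hqp (by simpa using hx m hxq))

/-- `C/aC` behaves over `R/a`, up to elements of `S`, like a semidualizing module. -/
structure SemidualizingModulo (S : Submonoid R) (C : Type u) [AddCommGroup C] [Module R C]
    (a : Ideal R) : Prop where
  extTorsion (i : ℕ) : ExtTorsion S C (C ⧸ (a • ⊤ : Submodule R C)) (i + 1)
  exists_smul_eq (φ : C →ₗ[R] C ⧸ (a • ⊤ : Submodule R C)) :
    ∃ s ∈ S, ∃ r : R, s • φ = r • (a • ⊤ : Submodule R C).mkQ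
  exists_mul_mem (r : R) : (∀ c : C, r • c ∈ (a • ⊤ : Submodule R C)) → ∃ s ∈ S, s * r ∈ a

namespace SemidualizingModulo

variable {S : Submonoid R} {C : Type u} [AddCommGroup C] [Module R C] {a : Ideal R} {x : R}

lemma bot (hC : IsSemidualizing R C) : SemidualizingModulo S C ⊥ where
  extTorsion i := (hC.extTorsion_self i).of_bot.congr_target
    (Submodule.quotEquivOfEqBot _ (Submodule.bot_smul _)).symm
  exists_smul_eq φ := by
    let e := Submodule.quotEquivOfEqBot ((⊥ : Ideal R) • ⊤ : Submodule R C) (Submodule.bot_smul _)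
    obtain ⟨r, hr⟩ := hC.2.1.2 (e.toLinearMap ∘ₗ φ)
    refine ⟨1, S.one_mem, r, LinearMap.ext fun c => e.injective ?_⟩
    have := LinearMap.congr_fun hr c
    simpa [e] using this.symm
  exists_mul_mem r hr := by
    refine ⟨1, S.one_mem, ?_⟩
    rw [one_mul, Ideal.mem_bot]
    refine hC.2.1.1 (LinearMap.ext fun c => ?_)
    simpa using hr c

lemma sup_span_singleton (h : SemidualizingModulo S C a)
    (hx : SmulRegularUpTo S (C ⧸ (a • ⊤ : Submodule R C)) x) :
    SemidualizingModulo S C (a ⊔ Ideal.span {x}) := by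
  obtain ⟨s₀, hs₀, hx⟩ := hx
  have hle : (a • ⊤ : Submodule R C) ≤ (a ⊔ Ideal.span {x}) • ⊤ :=
    Submodule.smul_mono_left le_sup_left
  have hker := ker_factor_eq_range (sup_span_singleton_smul_top_eq a x C) hle
  have hsurj := Submodule.factor_surjective hle
  set K := LinearMap.range (LinearMap.lsmul R (C ⧸ (a • ⊤ : Submodule R C)) x) with hK
  obtain ⟨g, hg⟩ := LinearMap.exists_comp_eq_of_surjective
    (LinearMap.surjective_rangeRestrict (LinearMap.lsmul R (C ⧸ (a • ⊤ : Submodule R C)) x))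
    (h := LinearMap.lsmul R _ s₀)
    (by rw [LinearMap.ker_rangeRestrict]; exact fun t ht => hx t ht)
  have hgx (y : K) : x • g y = s₀ • (y : C ⧸ (a • ⊤ : Submodule R C)) := by
    obtain ⟨_, t, rfl⟩ := y
    have : g ⟨x • t, t, rfl⟩ = s₀ • t := LinearMap.congr_fun hg t
    change x • g ⟨x • t, t, rfl⟩ = s₀ • x • t
    rw [this, smul_comm]
  have hexact : Function.Exact K.subtype (Submodule.factor hle) := by
    rw [LinearMap.exact_iff, hker, Submodule.range_subtype]
  have hKext (i : ℕ) : ExtTorsion S C K (i + 1) :=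
    (h.extTorsion i).of_smul_target (LinearMap.rangeRestrict _) g hs₀
      (LinearMap.ext fun y => Subtype.ext (hgx y))
  refine ⟨fun i => ExtTorsion.covariant₃ K.subtype_injective hexact hsurj (h.extTorsion i)
    (hKext (i + 1)), fun φ => ?_, fun r hr => ?_⟩
  · obtain ⟨s, hs, l, hl⟩ := (hKext 0).exists_lift K.subtype_injective hexact hsurj φ
    obtain ⟨t, ht, r, hr⟩ := h.exists_smul_eq l
    refine ⟨t * s, S.mul_mem ht hs, r, ?_⟩
    rw [mul_smul, ← hl, ← LinearMap.comp_smul, hr, LinearMap.comp_smul, Submodule.factor_comp_mk]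
  · have hrK (c : C) : (r • (a • ⊤ : Submodule R C).mkQ) c ∈ K := by
      rw [← hker, LinearMap.mem_ker]
      exact (Submodule.Quotient.mk_eq_zero _).mpr (hr c)
    let ψ : C →ₗ[R] K := (r • (a • ⊤ : Submodule R C).mkQ).codRestrict K hrK
    obtain ⟨t, ht, r', hr'⟩ := h.exists_smul_eq (g ∘ₗ ψ)
    obtain ⟨v, hv, hv'⟩ := h.exists_mul_mem (t * s₀ * r - x * r') fun c => by
      rw [← Submodule.Quotient.mk_eq_zero, sub_smul, Submodule.Quotient.mk_sub, sub_eq_zero]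
      have h1 : t • g (ψ c) = r' • Submodule.Quotient.mk c := LinearMap.congr_fun hr' c
      have h2 := hgx (ψ c)
      have h3 : (ψ c : C ⧸ (a • ⊤ : Submodule R C)) = r • Submodule.Quotient.mk c := rfl
      rw [Submodule.Quotient.mk_smul, Submodule.Quotient.mk_smul, mul_smul, mul_smul, mul_smul,
        ← h3, ← h2, ← h1, smul_comm t x]
    refine ⟨v * (t * s₀), S.mul_mem hv (S.mul_mem ht hs₀), ?_⟩
    have : v * (t * s₀) * r = v * (t * s₀ * r - x * r') + v * r' * x := by ring
    rw [this]
    exact Ideal.add_mem _ (Ideal.mem_sup_left hv')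
      (Ideal.mem_sup_right (Ideal.mul_mem_left _ _ (Ideal.mem_span_singleton_self x)))

lemma smulRegularUpTo [IsNoetherianRing R] (h : SemidualizingModulo S C a)
    (hx : SmulRegularUpTo S (C ⧸ (a • ⊤ : Submodule R C)) x) : SmulRegularUpTo S (R ⧸ a) x := by
  obtain ⟨s, hs, hx⟩ := hx
  refine .of_forall_exists fun m hm => ?_
  obtain ⟨r, rfl⟩ := Submodule.Quotient.mk_surjective _ m
  rw [← Submodule.Quotient.mk_smul, Submodule.Quotient.mk_eq_zero] at hm
  obtain ⟨t, ht, h'⟩ := h.exists_mul_mem (s * r) fun c => by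
    rw [← Submodule.Quotient.mk_eq_zero, mul_smul, Submodule.Quotient.mk_smul]
    refine hx _ ?_
    rw [← Submodule.Quotient.mk_smul, Submodule.Quotient.mk_eq_zero, ← mul_smul]
    exact Submodule.smul_mem_smul hm trivial
  refine ⟨t * s, S.mul_mem ht hs, ?_⟩
  rw [← Submodule.Quotient.mk_smul, Submodule.Quotient.mk_eq_zero, smul_eq_mul, mul_assoc]
  exact h'

end SemidualizingModulo

end Depth

section DepthExists

variable {R : Type u} [CommRing R] [IsNoetherianRing R] {C : Type u} [AddCommGroup C] [Module R C]

lemma SemidualizingModulo.exists_lt_of_notMem [Module.Finite R C] {p : PrimeSpectrum R}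
    {a : Ideal R} (hap : a ≤ p.asIdeal) (h : SemidualizingModulo p.asIdeal.primeCompl C a)
    (hp : p.asIdeal ∉ associatedPrimes R (C ⧸ (a • ⊤ : Submodule R C))) :
    ∃ q < p, a ≤ q.asIdeal := by
  have hle : Module.annihilator R (C ⧸ (a • ⊤ : Submodule R C)) ≤ p.asIdeal := fun r hr => by
    obtain ⟨s, hs, hsr⟩ := h.exists_mul_mem r fun c => by
      rw [← Submodule.Quotient.mk_eq_zero, Submodule.Quotient.mk_smul]
      exact Module.mem_annihilator.mp hr _
    exact (p.2.mem_or_mem (hap hsr)).resolve_left hs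
  obtain ⟨q, hq, hqp⟩ := Ideal.exists_minimalPrimes_le hle
  have hqa := Module.associatedPrimes.minimalPrimes_annihilator_subset_associatedPrimes R _ hq
  refine ⟨⟨q, hq.1.1⟩, lt_of_le_of_ne hqp ?_, le_trans (fun r hr => ?_) hq.1.2⟩
  · rintro rfl
    exact hp hqa
  · rw [Module.mem_annihilator]
    intro c
    obtain ⟨c, rfl⟩ := Submodule.Quotient.mk_surjective _ c
    rw [← Submodule.Quotient.mk_smul, Submodule.Quotient.mk_eq_zero]
    exact Submodule.smul_mem_smul hr trivial

lemma SemidualizingModulo.exists_regSeqUpTo [Module.Finite R C] {p : PrimeSpectrum R} (n : ℕ) :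
    ∀ {j : ℕ} {a : Ideal R}, a ≤ p.asIdeal → SemidualizingModulo p.asIdeal.primeCompl C a →
      RegSeqUpTo p.asIdeal.primeCompl C j a →
      (∀ l : LTSeries (PrimeSpectrum R), a ≤ l.head.asIdeal → l.last = p → l.length ≤ n) →
      ∃ j' ≤ j + n, ∃ a' : Ideal R, RegSeqUpTo p.asIdeal.primeCompl C j' a' ∧
        p.asIdeal ∈ associatedPrimes R (C ⧸ (a' • ⊤ : Submodule R C)) := by
  induction n with
  | zero =>
    intro j a hap h hj hl
    refine ⟨j, le_rfl, a, hj, ?_⟩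
    by_contra hp
    obtain ⟨q, hq, haq⟩ := h.exists_lt_of_notMem hap hp
    obtain ⟨l, hlh, hll⟩ : ∃ l : LTSeries (PrimeSpectrum R), l.head = p ∧ l.last = p :=
      ⟨RelSeries.singleton _ p, rfl, rfl⟩
    have := hl (l.cons q (by rwa [hlh])) (by simpa using haq) (by simpa using hll)
    simp at this
  | succ n ih =>
    intro j a hap h hj hl
    by_cases hp : p.asIdeal ∈ associatedPrimes R (C ⧸ (a • ⊤ : Submodule R C))
    · exact ⟨j, by omega, a, hj, hp⟩
    have hfin : {q ∈ associatedPrimes R (C ⧸ (a • ⊤ : Submodule R C)) | q ≤ p.asIdeal}.Finite :=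
      (associatedPrimes.finite R _).subset (Set.sep_subset _ _)
    obtain ⟨x, hxp, hx⟩ : ∃ x ∈ p.asIdeal,
        ∀ q ∈ associatedPrimes R (C ⧸ (a • ⊤ : Submodule R C)), q ≤ p.asIdeal → x ∉ q := by
      by_contra! H
      obtain ⟨q, hq, hpq⟩ := (Ideal.subset_union_prime (s := hfin.toFinset) (f := id) ⊥ ⊥
        (fun q hq _ _ => (hfin.mem_toFinset.mp hq).1.isPrime)).mp (fun x hx => by
          obtain ⟨q, hq, hqp, hxq⟩ := H x hx
          exact Set.mem_biUnion (hfin.mem_toFinset.mpr ⟨hq, hqp⟩) hxq)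
      obtain ⟨hq, hqp⟩ := hfin.mem_toFinset.mp hq
      exact hp (le_antisymm hqp hpq ▸ hq)
    have hreg := SmulRegularUpTo.of_notMem_associatedPrimes hx
    have hreg' := h.smulRegularUpTo hreg
    obtain ⟨j', hj', h'⟩ := ih (j := j + 1) (a := a ⊔ Ideal.span {x})
      (sup_le hap (by rwa [Ideal.span_singleton_le_iff_mem]))
      (h.sup_span_singleton hreg) (hj.cons hreg' hreg) (fun l hla hlp => by
        obtain ⟨q, hq, hql⟩ := Ideal.exists_minimalPrimes_le (le_sup_left.trans hla)
        have hlx : x ∈ l.head.asIdeal :=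
          hla (Ideal.mem_sup_right (Ideal.mem_span_singleton_self x))
        have hqa : q ∈ associatedPrimes R (R ⧸ a) := by
          refine Module.associatedPrimes.minimalPrimes_annihilator_subset_associatedPrimes R _ ?_
          rwa [Ideal.annihilator_quotient]
        have hxq := hreg'.notMem_of_mem_associatedPrimes hqa
          (hql.trans (hlp ▸ LTSeries.head_le_last l))
        have hlt : (⟨q, hq.1.1⟩ : PrimeSpectrum R) < l.head :=
          lt_of_le_of_ne hql fun h => hxq (by rwa [← h] at hlx)
        have := hl (l.cons ⟨q, hq.1.1⟩ hlt) (by simpa using hq.1.2) (by simpa using hlp)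
        simpa using this)
    exact ⟨j', by omega, h'⟩

lemma IsSemidualizing.exists_regSeqUpTo (hC : IsSemidualizing R C) {d : ℕ}
    (hd : ringKrullDim R = ((d : ℕ∞) : WithBot ℕ∞)) (p : Ideal R) [hp : p.IsPrime] :
    ∃ j ≤ d, ∃ a : Ideal R, RegSeqUpTo p.primeCompl C j a ∧
      ∃ ι : R ⧸ p →ₗ[R] C ⧸ (a • ⊤ : Submodule R C), Function.Injective ι := by
  have := hC.1
  obtain ⟨j, hj, a, ha, h⟩ := SemidualizingModulo.exists_regSeqUpTo (p := ⟨p, hp⟩) (C := C) d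
    bot_le (.bot hC) .nil fun l _ _ => by
      have := Order.LTSeries.length_le_krullDim l
      rw [← ringKrullDim, hd] at this
      exact_mod_cast this
  exact ⟨j, by omega, a, ha, ((isAssociatedPrime_iff_exists_injective_linearMap _ _).mp h).2⟩

end DepthExists

section Lifting

variable {R : Type u} [CommRing R] {I I' A B D : Type u} [AddCommGroup I] [Module R I]
  [AddCommGroup I'] [Module R I'] [AddCommGroup A] [Module R A] [AddCommGroup B] [Module R B]
  [AddCommGroup D] [Module R D]

/-- Every linear map from `A` to the codomain of `f` lifts along `f`. -/
def LinearMap.LiftsFrom (f : I →ₗ[R] I') (A : Type u) [AddCommGroup A] [Module R A] : Prop :=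
  ∀ g : A →ₗ[R] I', ∃ h : A →ₗ[R] I, f ∘ₗ h = g

namespace LinearMap.LiftsFrom

variable {f : I →ₗ[R] I'}

lemma exists_of_comp_eq_zero {i : A →ₗ[R] B} {π : B →ₗ[R] D} (hπ : Function.Surjective π)
    (hiπ : Function.Exact i π) (hD : f.LiftsFrom D) (g : B →ₗ[R] I') (hg : g ∘ₗ i = 0) :
    ∃ h : B →ₗ[R] I, f ∘ₗ h = g := by
  obtain ⟨k, rfl⟩ := LinearMap.exists_comp_eq_of_surjective hπ (h := g) (by
    rw [hiπ.linearMap_ker_eq]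
    exact LinearMap.range_le_ker_iff.mpr hg)
  obtain ⟨h, rfl⟩ := hD k
  exact ⟨h ∘ₗ π, rfl⟩

lemma of_exact [Module.Injective R I] {i : A →ₗ[R] B} {π : B →ₗ[R] D}
    (hi : Function.Injective i) (hiπ : Function.Exact i π) (hπ : Function.Surjective π)
    (hA : f.LiftsFrom A) (hD : f.LiftsFrom D) : f.LiftsFrom B := by
  intro g
  obtain ⟨h, hh⟩ := hA (g ∘ₗ i)
  obtain ⟨H, rfl⟩ := Module.Injective.exists_comp_eq i h (by
    rw [LinearMap.ker_eq_bot.mpr hi]; exact bot_le)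
  obtain ⟨k, hk⟩ := hD.exists_of_comp_eq_zero hπ hiπ (g - f ∘ₗ H) (by
    rw [LinearMap.sub_comp, ← hh, LinearMap.comp_assoc, sub_self])
  exact ⟨H + k, by rw [LinearMap.comp_add, hk, add_sub_cancel]⟩

lemma of_linearEquiv (e : A ≃ₗ[R] B) (hA : f.LiftsFrom A) : f.LiftsFrom B := by
  intro g
  obtain ⟨h, hh⟩ := hA (g ∘ₗ e.toLinearMap)
  refine ⟨h ∘ₗ e.symm.toLinearMap, LinearMap.ext fun b => ?_⟩
  simpa using LinearMap.congr_fun hh (e.symm b)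

lemma injective_ker [Module.Injective R I]
    (h : ∀ a : Ideal R, f.LiftsFrom (R ⧸ a)) : Module.Injective R (LinearMap.ker f) := by
  refine Module.Baer.injective fun a g => ?_
  obtain ⟨G, hG⟩ := Module.Injective.exists_comp_eq a.subtype ((LinearMap.ker f).subtype ∘ₗ g)
    (by rw [Submodule.ker_subtype]; exact bot_le)
  have hexact : Function.Exact a.subtype a.mkQ := by
    rw [LinearMap.exact_iff, Submodule.ker_mkQ, Submodule.range_subtype]
  obtain ⟨k, hk⟩ := LinearMap.exists_comp_eq_of_surjective a.mkQ_surjective (h := f ∘ₗ G) (by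
    rw [hexact.linearMap_ker_eq]
    refine LinearMap.range_le_ker_iff.mpr ?_
    rw [LinearMap.comp_assoc, hG, ← LinearMap.comp_assoc, LinearMap.comp_ker_subtype,
      LinearMap.zero_comp])
  obtain ⟨l, rfl⟩ := h a k
  refine ⟨(G - l ∘ₗ a.mkQ).codRestrict _ fun r => ?_, fun r hr => Subtype.ext ?_⟩
  · have : f (l (a.mkQ r)) = f (G r) := LinearMap.congr_fun hk r
    rw [LinearMap.mem_ker, LinearMap.sub_apply, map_sub, LinearMap.comp_apply, this, sub_self]
  · have h1 : G r = g ⟨r, hr⟩ := LinearMap.congr_fun hG ⟨r, hr⟩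
    have h2 : a.mkQ r = 0 := (Submodule.Quotient.mk_eq_zero a).mpr hr
    change G r - l (a.mkQ r) = _
    rw [h1, h2, map_zero, sub_zero]

/-- Lifting from `R/a` is detected up to nonzero multiples modulo primes. -/
lemma of_forall_prime [IsNoetherianRing R] [Module.Injective R I]
    (h : ∀ p : Ideal R, p.IsPrime → ∀ g : (R ⧸ p) →ₗ[R] I', ∃ s ∉ p,
      ∃ h : (R ⧸ p) →ₗ[R] I, f ∘ₗ h = s • g) (a : Ideal R) : f.LiftsFrom (R ⧸ a) := by
  induction a using WellFoundedGT.induction with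
  | ind a ih =>
  by_cases htop : a = ⊤
  · have : Subsingleton (R ⧸ a) := Submodule.Quotient.subsingleton_iff.mpr htop
    exact fun g => ⟨0, LinearMap.ext fun t => by
      rw [Subsingleton.elim t 0, map_zero, map_zero]⟩
  have hlt {x : R} (hx : x ∉ a) : a < a ⊔ Ideal.span {x} :=
    left_lt_sup.mpr fun hle => hx (hle (Ideal.mem_span_singleton_self x))
  have hker (x : R) := ker_factor_eq_range (sup_span_singleton_eq a x) le_sup_left
  have hsurj (x : R) := Submodule.factor_surjective (le_sup_left : a ≤ a ⊔ Ideal.span {x})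
  by_cases hprime : a.IsPrime
  · intro g
    obtain ⟨s, hs, k, hk⟩ := h a hprime g
    obtain ⟨k', rfl⟩ := Module.Injective.exists_comp_eq (LinearMap.lsmul R (R ⧸ a) s) k (by
      intro t ht
      obtain ⟨t, rfl⟩ := Submodule.Quotient.mk_surjective _ t
      have : s • (Submodule.Quotient.mk t : R ⧸ a) = 0 := ht
      rw [← Submodule.Quotient.mk_smul, Submodule.Quotient.mk_eq_zero, smul_eq_mul] at this
      rw [(Submodule.Quotient.mk_eq_zero a).mpr ((hprime.mem_or_mem this).resolve_left hs)]
      exact zero_mem _)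
    obtain ⟨l, hl⟩ := exists_of_comp_eq_zero (i := LinearMap.lsmul R (R ⧸ a) s) (hsurj s)
      ((LinearMap.exact_iff).mpr (hker s)) (ih _ (hlt hs)) (g - f ∘ₗ k') (by
        refine LinearMap.ext fun t => ?_
        have : f (k' (s • t)) = s • g t := LinearMap.congr_fun hk t
        change g (s • t) - f (k' (s • t)) = 0
        rw [this, map_smul, sub_self])
    exact ⟨k' + l, by rw [LinearMap.comp_add, hl, add_sub_cancel]⟩
  · obtain ⟨x, hx, y, hy, hxy⟩ := (Ideal.not_isPrime_iff.mp hprime).resolve_left htop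
    refine of_exact (LinearMap.range (LinearMap.lsmul R (R ⧸ a) x)).subtype_injective
      (by rw [LinearMap.exact_iff, hker, Submodule.range_subtype]) (hsurj x) ?_ (ih _ (hlt hx))
    let θ := (LinearMap.lsmul R (R ⧸ a) x).rangeRestrict ∘ₗ a.mkQ
    have hθ : Function.Surjective θ :=
      (LinearMap.surjective_rangeRestrict _).comp a.mkQ_surjective
    have hmem {r : R} : r ∈ LinearMap.ker θ ↔ x * r ∈ a := by
      rw [← Submodule.Quotient.mk_eq_zero a, LinearMap.mem_ker, Subtype.ext_iff]
      rfl
    refine (ih (LinearMap.ker θ) ?_).of_linearEquiv (θ.quotKerEquivOfSurjective hθ)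
    exact lt_of_le_of_ne (fun r hr => hmem.mpr (a.mul_mem_left x hr))
      fun h => hy (h ▸ hmem.mpr hxy)

end LinearMap.LiftsFrom

end Lifting

section Main

variable {R : Type u} [CommRing R] {C : Type u} [AddCommGroup C] [Module R C]

/-- The modules `Ext^i(R/a, M)`, `i ≥ 1`, vanish locally at each prime `p`, where `a` is generated
by at most `d` elements forming a regular sequence on `R` and `C` locally at `p`. -/
def RegSeqPerp (R : Type u) [CommRing R] (C : Type u) [AddCommGroup C] [Module R C] (d : ℕ)
    (M : Type u) [AddCommGroup M] [Module R M] : Prop :=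
  ∀ (p : Ideal R) [p.IsPrime] (j : ℕ) (a : Ideal R), j ≤ d → RegSeqUpTo p.primeCompl C j a →
    ∀ i, ExtTorsion p.primeCompl (R ⧸ a) M (i + 1)

lemma CGood.regSeqPerp {G : Type u} [AddCommGroup G] [Module R G] (hG : CGood R C G) (d : ℕ) :
    RegSeqPerp R C d G :=
  fun _ _ _ _ _ ha i => ha.extTorsion_of_cGood hG i

lemma CGICoresApprox.regSeqPerp [IsNoetherianRing R] (hC : IsSemidualizing R C) {d : ℕ}
    {M : ModuleCat.{u} R} (hM : CGICoresApprox R C d M) : RegSeqPerp R C d M :=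
  fun _ _ _ _ hj ha i => ha.extTorsion_of_cGICoresApprox hC hM (by omega)

/-- A surjection onto `Hom(C, I')` from `Hom(C, I)` whose kernel satisfies the vanishing condition
comes from a surjection `I → I'` with injective kernel. -/
lemma RegSeqPerp.exists_ker_equiv [IsNoetherianRing R] (hC : IsSemidualizing R C) {d : ℕ}
    (hd : ringKrullDim R = ((d : ℕ∞) : WithBot ℕ∞)) {I I' : Type u} [AddCommGroup I] [Module R I]
    [Module.Injective R I] [AddCommGroup I'] [Module R I'] [Module.Injective R I']
    {φ : (C →ₗ[R] I) →ₗ[R] (C →ₗ[R] I')} (hφ : Function.Surjective φ)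
    (h : RegSeqPerp R C d (LinearMap.ker φ)) :
    ∃ J : ModuleCat.{u} R, Module.Injective R J ∧
      Nonempty ((C →ₗ[R] J) ≃ₗ[R] LinearMap.ker φ) := by
  obtain ⟨f, hf, -⟩ := hC.exists_eq_compRight φ
  refine ⟨ModuleCat.of R (LinearMap.ker f), LinearMap.LiftsFrom.injective_ker
    (LinearMap.LiftsFrom.of_forall_prime fun p hp g => ?_), ⟨.ofBijective
      (((LinearMap.ker f).subtype.compRight R).codRestrict _ fun k => ?_) ⟨?_, ?_⟩⟩⟩
  · obtain ⟨j, hj, a, ha, ι, hι⟩ := hC.exists_regSeqUpTo hd p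
    obtain ⟨G, rfl⟩ := Module.Injective.exists_comp_eq ι g (by
      rw [LinearMap.ker_eq_bot.mpr hι]; exact bot_le)
    have ha0 {r : R} (hr : r ∈ a) (c : C) : (a • ⊤ : Submodule R C).mkQ (r • c) = 0 :=
      (Submodule.Quotient.mk_eq_zero _).mpr (Submodule.smul_mem_smul hr trivial)
    obtain ⟨s, hs, l, hl⟩ := (h p j a hj ha 0).exists_lift (LinearMap.ker φ).subtype_injective
      φ.exact_subtype_ker_map hφ (a.liftQ (LinearMap.toSpanSingleton R (C →ₗ[R] I')
        (G ∘ₗ (a • ⊤ : Submodule R C).mkQ)) fun r hr => LinearMap.ext fun c => by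
          change r • G ((a • ⊤ : Submodule R C).mkQ c) = 0
          rw [← map_smul, ← map_smul, ha0 hr, map_zero])
    obtain ⟨L, hL⟩ := LinearMap.exists_comp_eq_of_surjective (a • ⊤ : Submodule R C).mkQ_surjective
      (h := l (a.mkQ 1)) (by
        rw [Submodule.ker_mkQ, Submodule.smul_le]
        intro r hr c _
        have : r • a.mkQ 1 = 0 := by
          rw [← map_smul, smul_eq_mul, mul_one]
          exact (Submodule.Quotient.mk_eq_zero a).mpr hr
        rw [LinearMap.mem_ker, map_smul, ← LinearMap.smul_apply, ← map_smul, this, map_zero,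
          LinearMap.zero_apply])
    refine ⟨s, hs, L ∘ₗ ι, ?_⟩
    have : f ∘ₗ L = s • G := by
      refine LinearMap.ext fun t => ?_
      obtain ⟨c, rfl⟩ := Submodule.Quotient.mk_surjective _ t
      have h1 := LinearMap.congr_fun (LinearMap.congr_fun hl (a.mkQ 1)) c
      have h2 : L (Submodule.Quotient.mk c) = l (a.mkQ 1) c := LinearMap.congr_fun hL c
      rw [LinearMap.comp_apply, hf] at h1
      rw [LinearMap.comp_apply, h2]
      refine h1.trans ?_
      change s • (1 : R) • G _ = s • G _
      rw [one_smul]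
      rfl
    rw [← LinearMap.comp_assoc, this, LinearMap.smul_comp]
  · rw [LinearMap.mem_ker, hf]
    exact LinearMap.ext fun c => (k c).2
  · intro k k' hk
    refine LinearMap.ext fun c => Subtype.ext ?_
    exact LinearMap.congr_fun (congrArg Subtype.val hk) c
  · rintro ⟨k, hk⟩
    rw [LinearMap.mem_ker, hf] at hk
    exact ⟨k.codRestrict _ fun c => LinearMap.congr_fun hk c, Subtype.ext rfl⟩

lemma RegSeqPerp.cGood_ker [IsNoetherianRing R] (hC : IsSemidualizing R C) {d : ℕ}
    (hd : ringKrullDim R = ((d : ℕ∞) : WithBot ℕ∞)) {P I : Type u} [AddCommGroup P] [Module R P]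
    [AddCommGroup I] [Module R I] (hI : Module.Injective R I) (hP : CGood R C P)
    {π : P →ₗ[R] (C →ₗ[R] I)} (hπ : Function.Surjective π)
    (h : RegSeqPerp R C d (LinearMap.ker π)) : CGood R C (LinearMap.ker π) := by
  obtain ⟨I₁, hI₁, q, hq, hkq⟩ := hP.exists_cover
  let i : LinearMap.ker q →ₗ[R] LinearMap.ker (π ∘ₗ q) :=
    Submodule.inclusion (LinearMap.ker_le_ker_comp q π)
  let r : LinearMap.ker (π ∘ₗ q) →ₗ[R] LinearMap.ker π := q.restrict fun x hx => hx
  have hi : Function.Injective i := Submodule.inclusion_injective _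
  have hir : Function.Exact i r := by
    rintro ⟨x, hx⟩
    constructor
    · exact fun h => ⟨⟨x, congrArg Subtype.val h⟩, rfl⟩
    · rintro ⟨y, hy⟩
      rw [← hy]
      exact Subtype.ext y.2
  have hr : Function.Surjective r := by
    rintro ⟨x, hx⟩
    obtain ⟨y, rfl⟩ := hq x
    exact ⟨⟨y, hx⟩, rfl⟩
  obtain ⟨J, hJ, ⟨e⟩⟩ := RegSeqPerp.exists_ker_equiv hC hd (hπ.comp hq) (φ := π ∘ₗ q)
    fun p _ j a hj ha n => ExtTorsion.covariant₂ hi hir hr (hkq.regSeqPerp d p j a hj ha n)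
      (h p j a hj ha n)
  have hinj : Function.Injective (e.symm.toLinearMap ∘ₗ i) := e.symm.injective.comp hi
  have hsurj : Function.Surjective (r ∘ₗ e.toLinearMap) := hr.comp e.surjective
  have hexact : Function.Exact (e.symm.toLinearMap ∘ₗ i) (r ∘ₗ e.toLinearMap) := fun x => by
    refine (hir (e x)).trans ⟨fun ⟨y, hy⟩ => ⟨y, ?_⟩, fun ⟨y, hy⟩ => ⟨y, ?_⟩⟩
    · exact e.symm_apply_eq.mpr hy
    · exact e.symm_apply_eq.mp hy
  exact .of_exact hJ hkq (fun I' _ _ hI' n => ExtTorsion.covariant₃ hinj hexact hsurj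
    (hC.wPerp_hom hJ I' hI' n) (hkq.wPerp I' hI' (n + 1))) hinj hexact hsurj

lemma RegSeqPerp.cGood_of_exact [IsNoetherianRing R] (hC : IsSemidualizing R C) {d : ℕ}
    (hd : ringKrullDim R = ((d : ℕ∞) : WithBot ℕ∞)) {M G L : Type u} [AddCommGroup M] [Module R M]
    [AddCommGroup G] [Module R G] [AddCommGroup L] [Module R L] {f : M →ₗ[R] G} {g : G →ₗ[R] L}
    (hf : Function.Injective f) (hfg : Function.Exact f g)
    (hg : Function.Surjective g) (hG : CGood R C G) (hL : CGood R C L)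
    (h : RegSeqPerp R C d M) : CGood R C M := by
  obtain ⟨I, hI, p, hp, hkp⟩ := hL.exists_cover
  let P := LinearMap.eqLocus (g ∘ₗ LinearMap.fst R G (C →ₗ[R] I)) (p ∘ₗ LinearMap.snd R G _)
  let π₁ : P →ₗ[R] G := LinearMap.fst R G _ ∘ₗ P.subtype
  let π₂ : P →ₗ[R] (C →ₗ[R] I) := LinearMap.snd R G _ ∘ₗ P.subtype
  have hπ₁ : Function.Surjective π₁ := fun x => by
    obtain ⟨y, hy⟩ := hp (g x)
    exact ⟨⟨(x, y), hy.symm⟩, rfl⟩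
  have hπ₂ : Function.Surjective π₂ := fun y => by
    obtain ⟨x, hx⟩ := hg (p y)
    exact ⟨⟨(x, y), hx⟩, rfl⟩
  let i : LinearMap.ker p →ₗ[R] P :=
    (LinearMap.inr R G _ ∘ₗ (LinearMap.ker p).subtype).codRestrict P fun y =>
      (map_zero g).trans y.2.symm
  have hi : Function.Injective i := fun y z hyz =>
    Subtype.ext (congrArg (fun x : P => x.1.2) hyz)
  have hiπ : Function.Exact i π₁ := by
    rintro ⟨⟨x, y⟩, hxy⟩
    constructor
    · rintro (rfl : x = 0)
      exact ⟨⟨y, hxy.symm.trans (map_zero g)⟩, rfl⟩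
    · rintro ⟨y, hy⟩
      exact (congrArg (fun x : P => x.1.1) hy).symm
  have hP : CGood R C P := .of_extension hi hiπ hπ₁ hkp hG
  let e : M →ₗ[R] LinearMap.ker π₂ :=
    ((LinearMap.inl R G _ ∘ₗ f).codRestrict P fun m =>
      (hfg.apply_apply_eq_zero m).trans (map_zero p).symm).codRestrict _ fun m => rfl
  have he : Function.Bijective e := by
    refine ⟨fun m n hmn => hf (congrArg (fun x : LinearMap.ker π₂ => x.1.1.1) hmn), ?_⟩
    rintro ⟨⟨⟨x, y⟩, hxy⟩, (rfl : y = 0)⟩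
    obtain ⟨m, rfl⟩ := (hfg x).mp (hxy.trans (map_zero p))
    exact ⟨m, rfl⟩
  let e' := LinearEquiv.ofBijective e he
  exact (RegSeqPerp.cGood_ker hC hd hI hP hπ₂ fun p _ j a hj ha n =>
    (h p j a hj ha n).congr_target e').of_linearEquiv e'.symm

lemma CGidLE.cGood [IsNoetherianRing R] (hC : IsSemidualizing R C) {d : ℕ}
    (hd : ringKrullDim R = ((d : ℕ∞) : WithBot ℕ∞)) {n : ℕ} {M : ModuleCat.{u} R}
    (hM : CGidLE R C n M) (h : RegSeqPerp R C d M) : CGood R C M := by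
  induction n generalizing M with
  | zero => exact CGorensteinInjective.cGood hC hM
  | succ n ih =>
    obtain ⟨G, hG, f, hf, hL⟩ := hM
    have hG := CGorensteinInjective.cGood hC hG
    have hexact : Function.Exact f (LinearMap.range f).mkQ := by
      rw [LinearMap.exact_iff, Submodule.ker_mkQ]
    have hsurj := (LinearMap.range f).mkQ_surjective
    exact h.cGood_of_exact hC hd hf hexact hsurj hG (ih hL fun p _ j a hj ha i =>
      ExtTorsion.covariant₃ hf hexact hsurj (hG.regSeqPerp d p j a hj ha i)
        (h p j a hj ha (i + 1)))

end Main

/-- If `M` has finite `C`-Gorenstein injective dimension and there is an exact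
sequence `0 → N → G_{dim R} → ⋯ → G₁ → M → 0` with each `Gᵢ` `C`-Gorenstein injective, then
`M` is `C`-Gorenstein injective. -/
theorem statement1 (R : Type u) [CommRing R] [IsNoetherianRing R]
    (C : Type u) [AddCommGroup C] [Module R C] (hC : IsSemidualizing R C)
    (M : Type u) [AddCommGroup M] [Module R M]
    (hfin : CGid R C M ≠ ⊤)
    (d : ℕ) (hd : ringKrullDim R = ((d : ℕ∞) : WithBot ℕ∞))
    (happrox : CGICoresApprox R C d (ModuleCat.of R M)) :
    CGorensteinInjective R C M := by
  obtain ⟨_, n, rfl, hn⟩ : {n : ℕ∞ | ∃ m : ℕ, (m : ℕ∞) = n ∧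
      CGidLE R C m (ModuleCat.of R M)}.Nonempty := by
    by_contra h
    rw [Set.not_nonempty_iff_eq_empty] at h
    exact hfin (by rw [CGid, h, sInf_empty])
  exact (hn.cGood hC hd (happrox.regSeqPerp hC)).cGorensteinInjective
end

section
/- Let R be a commutative noetherian ring, let M be a nonzero R-module, and let p be a prime ideal of R. If M satisfies property t(p), then the small support of M equals {p}. -/
/-!
Common definitions: property t(p), injective hulls, (C-)Gorenstein injective modules,
(C-)Gorenstein injective / injective / flat dimensions, small support, torsion functor,
Tor and Ext modules, semidualizing and dualizing modules, depth, Cohen-Macaulay rings,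
Serre's condition (S₁), Gorenstein local rings, minimal injective resolutions.
-/

universe u

open CategoryTheory Limits DirectSum

open TensorProduct

lemma PropT.exists_powers_smul_eq_zero {R : Type u} [CommRing R] {p : Ideal R} {M : Type u}
    [AddCommGroup M] [Module R M] (hM : PropT R p M) {x : R} (hx : x ∈ p) (m : M) :
    ∃ s ∈ Submonoid.powers x, s • m = 0 := by
  obtain ⟨n, -, hn⟩ := hM.2 m
  exact ⟨x ^ n, ⟨n, rfl⟩, hn _ (Ideal.pow_mem_pow hx n)⟩

/-- The kernel of a surjection between flat modules is flat. -/
lemma Module.Flat.ker_of_surjective {R F G : Type*} [CommRing R] [AddCommGroup F] [Module R F]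
    [AddCommGroup G] [Module R G] [Module.Flat R F] [Module.Flat R G] (f : F →ₗ[R] G)
    (hf : Function.Surjective f) : Module.Flat R (LinearMap.ker f) := by
  rw [Module.Flat.iff_rTensor_injective']
  intro I
  have hinj := LinearMap.lTensor_injective_of_exact_of_flat f hf (LinearMap.ker f).subtype
    (Submodule.subtype_injective _) (LinearMap.exact_subtype_ker_map f) I
  have hcomp : (LinearMap.ker f).subtype.lTensor R ∘ₗ I.subtype.rTensor (LinearMap.ker f) =
      I.subtype.rTensor F ∘ₗ (LinearMap.ker f).subtype.lTensor I := by
    rw [LinearMap.lTensor_comp_rTensor, LinearMap.rTensor_comp_lTensor]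
  refine Function.Injective.of_comp (f := (LinearMap.ker f).subtype.lTensor R) ?_
  rw [← LinearMap.coe_comp, hcomp, LinearMap.coe_comp]
  exact (Module.Flat.rTensor_preserves_injective_linearMap _ I.subtype_injective).comp hinj

/-- A bounded below exact complex of flat modules remains exact after tensoring. -/
lemma lTensor_exact_of_flat_of_exact {R : Type*} [CommRing R] {X : ℕ → Type*}
    [∀ i, AddCommGroup (X i)] [∀ i, Module R (X i)] [∀ i, Module.Flat R (X i)]
    (d : ∀ i, X (i + 1) →ₗ[R] X i) (h₀ : Function.Surjective (d 0))
    (h : ∀ i, Function.Exact (d (i + 1)) (d i)) (N : Type*) [AddCommGroup N] [Module R N]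
    (i : ℕ) : Function.Exact ((d (i + 1)).lTensor N) ((d i).lTensor N) := by
  have hflat : ∀ i, Module.Flat R (LinearMap.range (d i)) := by
    intro i
    induction i with
    | zero =>
      rw [LinearMap.range_eq_top.mpr h₀]
      exact Module.Flat.of_linearEquiv Submodule.topEquiv
    | succ i ih =>
      rw [← (h i).linearMap_ker_eq, ← LinearMap.ker_rangeRestrict]
      exact Module.Flat.ker_of_surjective _ (d i).surjective_rangeRestrict
  have hsub : Function.Injective ((LinearMap.range (d i)).subtype.lTensor N) := by
    cases i with
    | zero =>
      rw [LinearMap.range_eq_top.mpr h₀]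
      exact (LinearEquiv.lTensor N (Submodule.topEquiv (R := R) (M := X 0))).injective
    | succ i =>
      refine LinearMap.lTensor_injective_of_exact_of_flat (d i).rangeRestrict
        (d i).surjective_rangeRestrict _ (Submodule.subtype_injective _) ?_ N
      rw [LinearMap.exact_iff, LinearMap.ker_rangeRestrict, Submodule.range_subtype]
      exact (h i).linearMap_ker_eq
  have hexact : Function.Exact (d (i + 1)) (d i).rangeRestrict := by
    rw [LinearMap.exact_iff, LinearMap.ker_rangeRestrict]
    exact (h i).linearMap_ker_eq
  have hd : (d i).lTensor N =
      (LinearMap.range (d i)).subtype.lTensor N ∘ₗ (d i).rangeRestrict.lTensor N := by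
    rw [← LinearMap.lTensor_comp]
    rfl
  intro z
  rw [hd, LinearMap.comp_apply, map_eq_zero_iff _ hsub]
  exact lTensor_exact N hexact (d i).surjective_rangeRestrict z

/-- If a complex becomes exact after localization, its homology is torsion. -/
lemma exists_smul_mem_range_of_localized_exact {R A B C A' B' C' : Type*} [CommRing R]
    (S : Submonoid R) [AddCommGroup A] [Module R A] [AddCommGroup B] [Module R B]
    [AddCommGroup C] [Module R C] [AddCommGroup A'] [Module R A'] [AddCommGroup B'] [Module R B']
    [AddCommGroup C'] [Module R C'] (α : A →ₗ[R] A') (β : B →ₗ[R] B') (γ : C →ₗ[R] C')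
    [IsLocalizedModule S α] [IsLocalizedModule S β]
    {f : A →ₗ[R] B} {g : B →ₗ[R] C} {f' : A' →ₗ[R] B'} {g' : B' →ₗ[R] C'}
    (hf : f' ∘ₗ α = β ∘ₗ f) (hg : g' ∘ₗ β = γ ∘ₗ g) (h : Function.Exact f' g')
    (z : B) (hz : g z = 0) : ∃ s ∈ S, ∃ w, f w = s • z := by
  obtain ⟨w', hw'⟩ := (h (β z)).mp (by
    rw [← LinearMap.comp_apply, hg, LinearMap.comp_apply, hz, map_zero])
  obtain ⟨⟨w, s⟩, hw⟩ := IsLocalizedModule.surj S α w'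
  have : β (s • z) = β (f w) := by
    rw [← LinearMap.comp_apply β f, ← hf, LinearMap.comp_apply, ← hw, LinearMap.map_smul_of_tower,
      LinearMap.map_smul_of_tower, hw']
  obtain ⟨t, ht⟩ := (IsLocalizedModule.eq_iff_exists S β).mp this
  refine ⟨t * s, (t * s).2, t • w, ?_⟩
  rw [LinearMap.map_smul_of_tower, ← ht]
  simp only [Submonoid.smul_def, mul_smul]

/-- The complex `N ⊗ K` is exact. -/
def TensorAcyclic {R : Type u} [CommRing R] (K : ChainComplex (ModuleCat.{u} R) ℕ)
    (N : Type u) [AddCommGroup N] [Module R N] : Prop :=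
  ∀ i, Function.Exact ((K.d (i + 1) i).hom.lTensor N) ((K.d i (i - 1)).hom.lTensor N)

namespace TensorAcyclic

variable {R : Type u} [CommRing R] {K : ChainComplex (ModuleCat.{u} R) ℕ}

lemma lTensor_d_lTensor_d (N : Type u) [AddCommGroup N] [Module R N] (i j k : ℕ)
    (z : N ⊗[R] K.X i) :
    (K.d j k).hom.lTensor N ((K.d i j).hom.lTensor N z) = 0 := by
  rw [← LinearMap.comp_apply, ← LinearMap.lTensor_comp, ← ModuleCat.hom_comp, K.d_comp_d]
  simp

lemma rTensor_lTensor_d {N N' : Type u} [AddCommGroup N] [Module R N] [AddCommGroup N']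
    [Module R N'] (f : N →ₗ[R] N') (i j : ℕ) (z : N ⊗[R] K.X i) :
    f.rTensor (K.X j) ((K.d i j).hom.lTensor N z) =
      (K.d i j).hom.lTensor N' (f.rTensor (K.X i) z) := by
  rw [← LinearMap.comp_apply, ← LinearMap.comp_apply, LinearMap.rTensor_comp_lTensor,
    LinearMap.lTensor_comp_rTensor]

lemma of_forall {N : Type u} [AddCommGroup N] [Module R N]
    (h : ∀ i (z : N ⊗[R] K.X i), (K.d i (i - 1)).hom.lTensor N z = 0 →
      ∃ w, (K.d (i + 1) i).hom.lTensor N w = z) : TensorAcyclic K N :=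
  fun i z ↦ ⟨h i z, by rintro ⟨w, rfl⟩; exact lTensor_d_lTensor_d N _ _ _ w⟩

lemma of_subsingleton (N : Type u) [AddCommGroup N] [Module R N] [Subsingleton N] :
    TensorAcyclic K N :=
  of_forall fun _ _ _ ↦ ⟨0, Subsingleton.elim _ _⟩

lemma of_linearEquiv {N N' : Type u} [AddCommGroup N] [Module R N] [AddCommGroup N']
    [Module R N'] (e : N ≃ₗ[R] N') (h : TensorAcyclic K N) : TensorAcyclic K N' := by
  refine of_forall fun i z hz ↦ ?_
  obtain ⟨w, hw⟩ := (h i ((e.symm : N' →ₗ[R] N).rTensor _ z)).mp (by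
    rw [← rTensor_lTensor_d, hz, map_zero])
  refine ⟨(e : N →ₗ[R] N').rTensor _ w, ?_⟩
  rw [← rTensor_lTensor_d, hw, ← LinearMap.comp_apply, ← LinearMap.rTensor_comp]
  simp

section Exact

variable [∀ i, Module.Flat R (K.X i)] {N₁ N₂ N₃ : Type u} [AddCommGroup N₁] [Module R N₁]
  [AddCommGroup N₂] [Module R N₂] [AddCommGroup N₃] [Module R N₃] {f : N₁ →ₗ[R] N₂}
  {g : N₂ →ₗ[R] N₃}

lemma of_exact (hf : Function.Injective f) (hg : Function.Surjective g)
    (hfg : Function.Exact f g) (h₁ : TensorAcyclic K N₁) (h₃ : TensorAcyclic K N₃) :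
    TensorAcyclic K N₂ := by
  refine of_forall fun i z hz ↦ ?_
  obtain ⟨v₃, hv₃⟩ := (h₃ i (g.rTensor _ z)).mp (by rw [← rTensor_lTensor_d, hz, map_zero])
  obtain ⟨v, rfl⟩ := LinearMap.rTensor_surjective _ hg v₃
  obtain ⟨u, hu⟩ := (rTensor_exact (K.X i) hfg hg (z - (K.d (i + 1) i).hom.lTensor N₂ v)).mp (by
    rw [map_sub, rTensor_lTensor_d, hv₃, sub_self])
  obtain ⟨t, rfl⟩ := (h₁ i u).mp (by
    apply Module.Flat.rTensor_preserves_injective_linearMap (M := K.X (i - 1)) f hf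
    rw [rTensor_lTensor_d, hu, map_sub, hz, lTensor_d_lTensor_d, sub_zero, map_zero])
  refine ⟨f.rTensor _ t + v, ?_⟩
  rw [map_add, ← rTensor_lTensor_d, hu, sub_add_cancel]

/-- If `N₃ ⊗ K` is exact, then the map on homology induced by `N₁ → N₂` is injective. -/
lemma mem_range_of_rTensor_mem_range (hf : Function.Injective f) (hg : Function.Surjective g)
    (hfg : Function.Exact f g) (h₃ : TensorAcyclic K N₃) (i : ℕ) (z : N₁ ⊗[R] K.X i)
    (w : N₂ ⊗[R] K.X (i + 1)) (hw : (K.d (i + 1) i).hom.lTensor N₂ w = f.rTensor _ z) :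
    ∃ v, (K.d (i + 1) i).hom.lTensor N₁ v = z := by
  obtain ⟨v₃, hv₃⟩ := (h₃ (i + 1) (g.rTensor _ w)).mp (by
    rw [← rTensor_lTensor_d, Nat.add_sub_cancel, hw]
    exact (rTensor_exact (K.X i) hfg hg _).mpr ⟨z, rfl⟩)
  obtain ⟨v, rfl⟩ := LinearMap.rTensor_surjective _ hg v₃
  obtain ⟨u, hu⟩ := (rTensor_exact (K.X (i + 1)) hfg hg
    (w - (K.d (i + 1 + 1) (i + 1)).hom.lTensor N₂ v)).mp (by
      rw [map_sub, rTensor_lTensor_d, hv₃, sub_self])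
  refine ⟨u, Module.Flat.rTensor_preserves_injective_linearMap (M := K.X i) f hf ?_⟩
  rw [rTensor_lTensor_d, hu, map_sub, lTensor_d_lTensor_d, sub_zero, hw]

end Exact

/-- If `N ⊗ K` becomes exact after localizing at `S`, then its homology is `S`-torsion. -/
lemma exists_smul_mem_range_of_isLocalizedModule (S : Submonoid R) {N N' : Type u}
    [AddCommGroup N] [Module R N] [AddCommGroup N'] [Module R N'] (f : N →ₗ[R] N')
    [IsLocalizedModule S f] (h : TensorAcyclic K N') (i : ℕ) (z : N ⊗[R] K.X i)
    (hz : (K.d i (i - 1)).hom.lTensor N z = 0) :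
    ∃ s ∈ S, ∃ w, (K.d (i + 1) i).hom.lTensor N w = s • z := by
  have hloc (j : ℕ) : IsLocalizedModule S (f.rTensor (K.X j)) :=
    inferInstanceAs (IsLocalizedModule S (AlgebraTensorModule.rTensor R (K.X j) f))
  exact exists_smul_mem_range_of_localized_exact S (f.rTensor (K.X (i + 1)))
    (f.rTensor (K.X i)) (f.rTensor (K.X (i - 1)))
    (LinearMap.ext fun x ↦ (rTensor_lTensor_d f _ _ x).symm)
    (LinearMap.ext fun x ↦ (rTensor_lTensor_d f _ _ x).symm) (h i) z hz

end TensorAcyclic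

namespace CategoryTheory.ProjectiveResolution

variable {R : Type u} [CommRing R] {M : Type u} [AddCommGroup M] [Module R M]
  (P : ProjectiveResolution (ModuleCat.of R M))

instance flat_X (i : ℕ) : Module.Flat R (P.complex.X i) :=
  have : Module.Projective R (P.complex.X i) := ModuleCat.projective_of_module_projective _
  inferInstance

lemma function_exact_succ (i : ℕ) :
    Function.Exact (P.complex.d (i + 2) (i + 1)).hom (P.complex.d (i + 1) i).hom :=
  (ShortComplex.ShortExact.moduleCat_exact_iff_function_exact _).mp (P.exact_succ i)

lemma exists_surjective_exact :
    ∃ ε : P.complex.X 0 →ₗ[R] M, Function.Surjective ε ∧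
      Function.Exact (P.complex.d 1 0).hom ε :=
  ⟨(P.π.f 0).hom, (ModuleCat.epi_iff_surjective (P.π.f 0)).mp inferInstance,
    (ShortComplex.ShortExact.moduleCat_exact_iff_function_exact _).mp P.exact₀⟩

lemma subsingleton_tor_iff (N : Type u) [AddCommGroup N] [Module R N] (i : ℕ) :
    Subsingleton (TorM R i N M) ↔ Function.Exact ((P.complex.d (i + 1) i).hom.lTensor N)
      ((P.complex.d i (i - 1)).hom.lTensor N) := by
  let F := (MonoidalCategory.tensoringLeft (ModuleCat.{u} R)).obj (ModuleCat.of R N)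
  have e : TorM R i N M ≅ ((F.mapHomologicalComplex _).obj P.complex).homology i :=
    P.isoLeftDerivedObj F i
  rw [← ModuleCat.isZero_iff_subsingleton, e.isZero_iff,
    ← HomologicalComplex.exactAt_iff_isZero_homology,
    HomologicalComplex.exactAt_iff' _ (i + 1) i (i - 1) (by simp) (by cases i <;> simp),
    ShortComplex.ShortExact.moduleCat_exact_iff_function_exact]
  rfl

/-- If `r` acts bijectively on `M`, it acts injectively on `Tor(N, M)`. -/
lemma mem_range_of_smul_mem_range {r : R} (hr : Function.Bijective (fun m : M ↦ r • m))
    (N : Type u) [AddCommGroup N] [Module R N] (i : ℕ) (z : N ⊗[R] P.complex.X i)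
    (hz : (P.complex.d i (i - 1)).hom.lTensor N z = 0) (w : N ⊗[R] P.complex.X (i + 1))
    (hw : (P.complex.d (i + 1) i).hom.lTensor N w = r • z) :
    ∃ v, (P.complex.d (i + 1) i).hom.lTensor N v = z := by
  let e : M ≃ₗ[R] M := LinearEquiv.ofBijective (LinearMap.lsmul R M r) hr
  let φ : ModuleCat.of R M ⟶ ModuleCat.of R M := ModuleCat.ofHom e.symm
  let g := lift φ P P
  have hg : (r • g) ≫ P.π = P.π ≫ (ChainComplex.single₀ _).map (𝟙 _) := by
    refine HomologicalComplex.to_single_hom_ext ?_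
    suffices r • P.π.f 0 ≫ φ = P.π.f 0 by simpa [g]
    ext x
    exact e.apply_symm_apply ((P.π.f 0).hom x)
  have H : Homotopy (r • g) (𝟙 P.complex) := liftHomotopy (𝟙 _) _ _ hg (by simp)
  have hcomm := H.comm i
  rw [dNext_nat, Homotopy.prevD_chainComplex] at hcomm
  have hcomm' := congrArg (fun q ↦ q.hom.lTensor N z) hcomm
  have hgd : (g.f i).hom ∘ₗ (P.complex.d (i + 1) i).hom =
      (P.complex.d (i + 1) i).hom ∘ₗ (g.f (i + 1)).hom :=
    congrArg ModuleCat.Hom.hom (g.comm (i + 1) i).symm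
  have hrz : (g.f i).hom.lTensor N (r • z) =
      (P.complex.d (i + 1) i).hom.lTensor N ((g.f (i + 1)).hom.lTensor N w) := by
    rw [← hw, ← LinearMap.comp_apply, ← LinearMap.lTensor_comp, hgd, LinearMap.lTensor_comp,
      LinearMap.comp_apply]
  simp only [HomologicalComplex.smul_f_apply, HomologicalComplex.id_f, ModuleCat.hom_add,
    ModuleCat.hom_smul, ModuleCat.hom_comp, ModuleCat.hom_id, LinearMap.lTensor_add,
    LinearMap.lTensor_smul, LinearMap.lTensor_comp, LinearMap.add_apply, LinearMap.smul_apply,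
    LinearMap.comp_apply, hz, map_zero, zero_add, LinearMap.lTensor_id, LinearMap.id_apply]
    at hcomm'
  rw [← map_smul, hrz] at hcomm'
  exact ⟨(g.f (i + 1)).hom.lTensor N w - (H.hom i (i + 1)).hom.lTensor N z, by
    rw [map_sub, hcomm', add_sub_cancel_left]⟩

/-- If `M` is `S`-torsion, then so is `Tor(N, M)`. -/
lemma exists_smul_mem_range (S : Submonoid R) (hM : ∀ m : M, ∃ s ∈ S, s • m = 0)
    (N : Type u) [AddCommGroup N] [Module R N] (i : ℕ) (z : N ⊗[R] P.complex.X i)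
    (hz : (P.complex.d i (i - 1)).hom.lTensor N z = 0) :
    ∃ s ∈ S, ∃ w, (P.complex.d (i + 1) i).hom.lTensor N w = s • z := by
  let L (j : ℕ) := LocalizedModule S (P.complex.X j)
  let ι (j : ℕ) : P.complex.X j →ₗ[R] L j := LocalizedModule.mkLinearMap S _
  let δ (j k : ℕ) : L j →ₗ[R] L k := IsLocalizedModule.map S (ι j) (ι k) (P.complex.d j k).hom
  have hδ (j k : ℕ) : δ j k ∘ₗ ι j = ι k ∘ₗ (P.complex.d j k).hom :=
    IsLocalizedModule.map_comp S (ι j) (ι k) _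
  have hflat (j : ℕ) : Module.Flat R (L j) :=
    have : Module.Flat (Localization S) (L j) := Module.Flat.localizedModule S
    have : Module.Flat R (Localization S) := IsLocalization.flat _ S
    Module.Flat.trans R (Localization S) (L j)
  have hexact (j : ℕ) : Function.Exact (δ (j + 2) (j + 1)) (δ (j + 1) j) :=
    IsLocalizedModule.map_exact S _ _ _ _ _ (P.function_exact_succ j)
  have hsurj : Function.Surjective (δ 1 0) := by
    obtain ⟨ε, -, hε⟩ := P.exists_surjective_exact
    have : Subsingleton (LocalizedModule S M) := by
      rw [LocalizedModule.subsingleton_iff]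
      exact fun m ↦ hM m
    intro y
    exact (IsLocalizedModule.map_exact S (ι 1) (ι 0) (LocalizedModule.mkLinearMap S M) _ _ hε
      y).mp (Subsingleton.elim _ _)
  have hacyc : Function.Exact ((δ (i + 1) i).lTensor N) ((δ i (i - 1)).lTensor N) := by
    cases i with
    | succ i => exact lTensor_exact_of_flat_of_exact (fun j ↦ δ (j + 1) j) hsurj hexact N i
    | zero =>
      have h0 : δ 0 (0 - 1) = 0 := by
        simp only [δ]
        rw [P.complex.shape _ _ (by simp)]
        simp
      intro y
      simpa [h0] using LinearMap.lTensor_surjective N hsurj y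
  have hloc (j : ℕ) : IsLocalizedModule S ((ι j).lTensor N) := by
    have : IsLocalizedModule S ((ι j).rTensor N) :=
      inferInstanceAs (IsLocalizedModule S (AlgebraTensorModule.rTensor R N (ι j)))
    have hcomm : (ι j).lTensor N = (TensorProduct.comm R (L j) N).toLinearMap ∘ₗ
        (ι j).rTensor N ∘ₗ (TensorProduct.comm R N (P.complex.X j)).toLinearMap := by
      ext
      simp
    rw [hcomm]
    infer_instance
  refine exists_smul_mem_range_of_localized_exact S ((ι (i + 1)).lTensor N)
    ((ι i).lTensor N) ((ι (i - 1)).lTensor N) ?_ ?_ hacyc z hz <;>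
  rw [← LinearMap.lTensor_comp, ← LinearMap.lTensor_comp, hδ]

lemma tensorAcyclic_of_smul_eq_zero {r : R} (hr : Function.Bijective (fun m : M ↦ r • m))
    (N : Type u) [AddCommGroup N] [Module R N] (hN : ∀ n : N, r • n = 0) :
    TensorAcyclic P.complex N := by
  refine TensorAcyclic.of_forall fun i z hz ↦ P.mem_range_of_smul_mem_range hr N i z hz 0 ?_
  have hr0 : r • (LinearMap.id : N →ₗ[R] N) = 0 := LinearMap.ext hN
  have := LinearMap.congr_fun (congrArg (LinearMap.rTensor (P.complex.X i)) hr0) z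
  simpa [LinearMap.rTensor_smul] using this.symm

lemma tensorAcyclic_of_bijective_smul (S : Submonoid R) (hM : ∀ m : M, ∃ s ∈ S, s • m = 0)
    (N : Type u) [AddCommGroup N] [Module R N]
    (hN : ∀ s ∈ S, Function.Bijective (fun n : N ↦ s • n)) : TensorAcyclic P.complex N := by
  refine TensorAcyclic.of_forall fun i z hz ↦ ?_
  obtain ⟨s, hs, w, hw⟩ := P.exists_smul_mem_range S hM N i z hz
  let e : N ≃ₗ[R] N := LinearEquiv.ofBijective (LinearMap.lsmul R N s) (hN s hs)
  have he : s • (e.symm : N →ₗ[R] N) = LinearMap.id := LinearMap.ext e.apply_symm_apply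
  refine ⟨(e.symm : N →ₗ[R] N).rTensor _ w, ?_⟩
  rw [← TensorAcyclic.rTensor_lTensor_d, hw, map_smul, ← LinearMap.smul_apply,
    ← LinearMap.rTensor_smul, he, LinearMap.rTensor_id, LinearMap.id_apply]

lemma not_tensorAcyclic_self [Nontrivial M] : ¬ TensorAcyclic P.complex R := by
  intro h
  obtain ⟨ε, hε, hexact⟩ := P.exists_surjective_exact
  obtain ⟨m, hm⟩ := exists_ne (0 : M)
  obtain ⟨x, rfl⟩ := hε m
  obtain ⟨w, hw⟩ := (h 0 (1 ⊗ₜ x)).mp (by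
    rw [P.complex.shape _ _ (by simp)]
    simp)
  refine hm ((hexact x).mpr ⟨TensorProduct.lid R _ w, ?_⟩)
  have hlid : (TensorProduct.lid R _).toLinearMap ∘ₗ (P.complex.d 1 0).hom.lTensor R =
      (P.complex.d 1 0).hom ∘ₗ (TensorProduct.lid R _).toLinearMap := by
    ext
    simp
  have := LinearMap.congr_fun hlid w
  simp only [LinearMap.comp_apply, LinearEquiv.coe_coe] at this
  rw [← this, hw, TensorProduct.lid_tmul, one_smul]

/-- If `M` satisfies `t(p)` and `Tor(R ⧸ p, M) = 0`, then `Tor(N, M) = 0` for every finitely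
generated module `N`. -/
lemma tensorAcyclic_of_quotient [IsNoetherianRing R] {p : Ideal R} (hM : PropT R p M)
    (hp : TensorAcyclic P.complex (R ⧸ p)) (I : Ideal R) :
    ∀ (N : Type u) [AddCommGroup N] [Module R N] [Module.Finite R N],
      I ≤ Module.annihilator R N → TensorAcyclic P.complex N := by
  induction I using IsNoetherian.induction with
  | hgt I ih =>
  intro N _ _ hfin
  induction hfin using IsNoetherianRing.induction_on_isQuotientEquivQuotientPrime with
  | subsingleton N => exact fun _ ↦ TensorAcyclic.of_subsingleton N
  | exact N₁ N₂ N₃ f g hf hg hfg h₁ h₃ =>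
    exact fun hI ↦ TensorAcyclic.of_exact hf hg hfg
      (h₁ (hI.trans (f.annihilator_le_of_injective hf)))
      (h₃ (hI.trans (g.annihilator_le_of_surjective hg)))
  | quotient N q e =>
    intro hI
    rw [e.annihilator_eq, Ideal.annihilator_quotient] at hI
    refine TensorAcyclic.of_linearEquiv e.symm ?_
    by_cases hqp : q.asIdeal ≤ p
    · obtain heq | hlt := hqp.eq_or_lt
      · rwa [heq]
      · obtain ⟨x, hxp, hxq⟩ := SetLike.exists_of_lt hlt
        let f : R ⧸ q.asIdeal →ₗ[R] R ⧸ q.asIdeal := LinearMap.lsmul R _ x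
        have hf : Function.Injective f := by
          rw [injective_iff_map_eq_zero]
          intro a ha
          obtain ⟨a, rfl⟩ := Ideal.Quotient.mk_surjective a
          have : Ideal.Quotient.mk q.asIdeal (x * a) = 0 := ha
          rw [Ideal.Quotient.eq_zero_iff_mem] at this ⊢
          exact (q.isPrime.mem_or_mem this).resolve_left hxq
        have hcoker : TensorAcyclic P.complex ((R ⧸ q.asIdeal) ⧸ LinearMap.range f) := by
          refine ih (I ⊔ Ideal.span {x}) ?_ _ ?_
          · refine lt_of_le_of_ne le_sup_left fun h ↦ hxq (hI ?_)
            rw [h]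
            exact Ideal.mem_sup_right (Ideal.mem_span_singleton_self x)
          · refine sup_le (hI.trans ?_) ?_
            · conv_lhs => rw [← Ideal.annihilator_quotient (I := q.asIdeal)]
              exact LinearMap.annihilator_le_of_surjective _ (Submodule.mkQ_surjective _)
            · rw [Ideal.span_singleton_le_iff_mem, Module.mem_annihilator]
              intro a
              obtain ⟨a, rfl⟩ := Submodule.mkQ_surjective _ a
              rw [← map_smul, Submodule.mkQ_apply, Submodule.Quotient.mk_eq_zero]
              exact ⟨a, rfl⟩
        refine TensorAcyclic.of_forall fun i z hz ↦ ?_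
        obtain ⟨s, ⟨n, rfl⟩, hs⟩ := P.exists_smul_mem_range (Submonoid.powers x)
          (hM.exists_powers_smul_eq_zero hxp) _ i z hz
        induction n with
        | zero => simpa using hs
        | succ n ihn =>
          obtain ⟨w, hw⟩ := hs
          refine ihn (TensorAcyclic.mem_range_of_rTensor_mem_range hf
            (Submodule.mkQ_surjective _) (LinearMap.exact_map_mkQ_range f) hcoker i _ w ?_)
          rw [hw]
          dsimp only
          rw [pow_succ', mul_smul]
          have : f = x • LinearMap.id := rfl
          simpa [this, LinearMap.rTensor_smul] using smul_comm x (x ^ n) z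
    · obtain ⟨r, hrq, hrp⟩ := SetLike.not_le_iff_exists.mp hqp
      refine P.tensorAcyclic_of_smul_eq_zero (hM.1 r hrp) _ ?_
      rw [← Module.mem_annihilator, Ideal.annihilator_quotient]
      exact hrq

/-- If `Tor(κ(p), M) = 0` and elements outside `p` act bijectively on `M`, then
`Tor(R ⧸ p, M) = 0`. -/
lemma tensorAcyclic_quotient_of_residueField {p : Ideal R} [p.IsPrime]
    (hM : ∀ r ∉ p, Function.Bijective (fun m : M ↦ r • m))
    (h : TensorAcyclic P.complex p.ResidueField) : TensorAcyclic P.complex (R ⧸ p) := by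
  have hloc : IsLocalization (Algebra.algebraMapSubmonoid (R ⧸ p) p.primeCompl)
      p.ResidueField := by
    have : Algebra.algebraMapSubmonoid (R ⧸ p) p.primeCompl = nonZeroDivisors (R ⧸ p) := by
      ext x
      obtain ⟨x, rfl⟩ := Ideal.Quotient.mk_surjective x
      rw [mem_nonZeroDivisors_iff_ne_zero, Ne, Ideal.Quotient.eq_zero_iff_mem]
      refine ⟨?_, fun hx ↦ ⟨x, hx, rfl⟩⟩
      rintro ⟨y, hy, hyx⟩ hx
      rw [← Ideal.Quotient.eq_zero_iff_mem, ← hyx] at hx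
      exact hy (Ideal.Quotient.eq_zero_iff_mem.mp hx)
    rw [this]
    infer_instance
  have := (isLocalizedModule_iff_isLocalization (S := p.primeCompl) (A := R ⧸ p)
    (Aₛ := p.ResidueField)).mpr hloc
  refine TensorAcyclic.of_forall fun i z hz ↦ ?_
  obtain ⟨s, hs, w, hw⟩ := TensorAcyclic.exists_smul_mem_range_of_isLocalizedModule p.primeCompl
    (IsScalarTower.toAlgHom R (R ⧸ p) p.ResidueField).toLinearMap h i z hz
  exact P.mem_range_of_smul_mem_range (hM s hs) _ i z hz w hw

lemma mem_smallSupport_iff (q : PrimeSpectrum R) :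
    q ∈ smallSupport R M ↔ ¬ TensorAcyclic P.complex q.asIdeal.ResidueField := by
  simp only [smallSupport, Set.mem_ofPred_eq, ← not_subsingleton_iff_nontrivial,
    P.subsingleton_tor_iff, TensorAcyclic, not_forall]

end CategoryTheory.ProjectiveResolution

/-- If a nonzero module `M` satisfies `t(p)`, then its small support is `{p}`. -/
theorem statement3 (R : Type u) [CommRing R] [IsNoetherianRing R]
    (M : Type u) [AddCommGroup M] [Module R M] [Nontrivial M]
    (p : Ideal R) (hp : p.IsPrime) (hM : PropT R p M) :
    smallSupport R M = {(⟨p, hp⟩ : PrimeSpectrum R)} := by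
  let P := projectiveResolution (ModuleCat.of R M)
  ext q
  rw [P.mem_smallSupport_iff, Set.mem_singleton_iff]
  refine ⟨fun hq ↦ ?_, ?_⟩
  · contrapose! hq
    by_cases hqp : q.asIdeal ≤ p
    · have hlt : q.asIdeal < p := lt_of_le_of_ne hqp fun h ↦ hq (PrimeSpectrum.ext h)
      obtain ⟨x, hxp, hxq⟩ := SetLike.exists_of_lt hlt
      refine P.tensorAcyclic_of_bijective_smul (Submonoid.powers x)
        (hM.exists_powers_smul_eq_zero hxp) _ ?_
      rintro _ ⟨n, rfl⟩
      have hunit : algebraMap R q.asIdeal.ResidueField (x ^ n) ≠ 0 := by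
        rw [Ne, Ideal.algebraMap_residueField_eq_zero]
        exact fun h ↦ hxq (q.isPrime.mem_of_pow_mem n h)
      simp only [Algebra.smul_def]
      exact mulLeft_bijective₀ _ hunit
    · obtain ⟨r, hrq, hrp⟩ := SetLike.not_le_iff_exists.mp hqp
      refine P.tensorAcyclic_of_smul_eq_zero (hM.1 r hrp) _ fun a ↦ ?_
      rw [Algebra.smul_def, Ideal.algebraMap_residueField_eq_zero.mpr hrq, zero_mul]
  · rintro rfl h
    exact P.not_tensorAcyclic_self (P.tensorAcyclic_of_quotient hM
      (P.tensorAcyclic_quotient_of_residueField hM.1 h) ⊥ R bot_le)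
end
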